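/- Fused antisymmetrizer identity for inverse R-matrices: for 2 ≤ k ≤ N and generic ξ ∈ ℂ, assuming each matrix R_{i0}(q^{i−1}z) is invertible, on (ℂ^N)^{⊗(k+1)} with factors labelled 1, …, k, 0 one has R₁₀(z)^{−1} · R₂₀(qz)^{−1} ⋯ R_{k0}(q^{k−1}z)^{−1} · A_k = A_k · R₁₀(z)^{−1} · R₂₀(qz)^{−1} ⋯ R_{k0}(q^{k−1}z)^{−1} · A_k, where R_{i0}(w) denotes the Belavin R-matrix evaluated at argument w (i.e. at ξ + (i−1)ζ for w = q^{i−1}z) acting on factors i and 0, and A_k is the antisymmetrizer acting on factors 1, …, k and as the identity on factor 0. -/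

import Mathlib

open Complex Matrix Kronecker

noncomputable section

/-- `eπ x = exp(iπx)`; the variables `z, q, p` of the paper are `eπ ξ, eπ ζ, eπ (2τ)`. -/
def eπ (x : ℂ) : ℂ := Complex.exp (Real.pi * Complex.I * x)

/-- Jacobi theta function with characteristics `ϑ[γ₁,γ₂](u,τ)`. -/
def jTheta (γ₁ γ₂ : ℝ) (u τ : ℂ) : ℂ :=
  ∑' m : ℤ, Complex.exp (Real.pi * Complex.I * ((m : ℂ) + (γ₁ : ℂ)) ^ 2 * τ +
    2 * Real.pi * Complex.I * ((m : ℂ) + (γ₁ : ℂ)) * (u + (γ₂ : ℂ)))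

/-- single infinite Pochhammer symbol `(x;s)_∞`. -/
def poch1 (x s : ℂ) : ℂ := ∏' n : ℕ, (1 - x * s ^ n)

/-- double infinite Pochhammer symbol `(x;p₁,p₂)_∞`. -/
def poch2 (x p₁ p₂ : ℂ) : ℂ := ∏' n : ℕ × ℕ, (1 - x * p₁ ^ n.1 * p₂ ^ n.2)

/-- Jacobi `Θ_s(x)` function. -/
def ThetaF (s x : ℂ) : ℂ := poch1 x s * poch1 (s * x⁻¹) s * poch1 s s

/-- numerator of `1/κ(z²)`, with `z = eπ ξ`, `q = eπ ζ`, `p = eπ (2τ)`. -/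
def kappaNum (N : ℕ) (ξ ζ τ : ℂ) : ℂ :=
  poch2 (eπ (2 * N * ζ - 2 * ξ)) (eπ (2 * τ)) (eπ (2 * N * ζ)) *
  poch2 (eπ (2 * ζ + 2 * ξ)) (eπ (2 * τ)) (eπ (2 * N * ζ)) *
  poch2 (eπ (2 * τ - 2 * ξ)) (eπ (2 * τ)) (eπ (2 * N * ζ)) *
  poch2 (eπ (2 * τ + (2 * N - 2) * ζ + 2 * ξ)) (eπ (2 * τ)) (eπ (2 * N * ζ))

/-- denominator of `1/κ(z²)`: the numerator with `ξ → -ξ`. -/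
def kappaDen (N : ℕ) (ξ ζ τ : ℂ) : ℂ := kappaNum N (-ξ) ζ τ

/-- the diagonal matrix `g^{1/2}` with entries `e^{iπj/N}`, `1 ≤ j ≤ N`. -/
def gHalf (N : ℕ) : Matrix (Fin N) (Fin N) ℂ :=
  Matrix.diagonal fun j => eπ ((((j : ℕ) : ℂ) + 1) / N)

/-- the diagonal matrix `g` with entries `ω^j = e^{2iπj/N}`, `1 ≤ j ≤ N`. -/
def gMat (N : ℕ) : Matrix (Fin N) (Fin N) ℂ :=
  Matrix.diagonal fun j => eπ (2 * (((j : ℕ) : ℂ) + 1) / N)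

/-- the shift matrix `h`, `h_{jl} = δ_{j+1,l}` (mod `N`). -/
def hMat (N : ℕ) : Matrix (Fin N) (Fin N) ℂ :=
  Matrix.of fun j l => if (l : ℕ) = ((j : ℕ) + 1) % N then 1 else 0

/-- `I_{(α₁,α₂)} = g^{α₂} h^{α₁}`. -/
def Imat (N : ℕ) (α : Fin N × Fin N) : Matrix (Fin N) (Fin N) ℂ :=
  gMat N ^ (α.2 : ℕ) * hMat N ^ (α.1 : ℕ)

/-- the coefficient `W_{(α₁,α₂)}(ξ,ζ,τ)`. -/
def Wcoef (N : ℕ) (α : Fin N × Fin N) (ξ ζ τ : ℂ) : ℂ :=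
  jTheta (1/2 + (α.1 : ℕ) / N) (1/2 + (α.2 : ℕ) / N) (ξ + ζ / N) τ /
    (N * jTheta (1/2 + (α.1 : ℕ) / N) (1/2 + (α.2 : ℕ) / N) (ζ / N) τ)

/-- the matrix `𝒵(z)`, `z = eπ ξ`. -/
def Zmat (N : ℕ) (ξ ζ τ : ℂ) : Matrix (Fin N × Fin N) (Fin N × Fin N) ℂ :=
  (eπ (ξ * (2 / N - 2)) * (kappaNum N ξ ζ τ / kappaDen N ξ ζ τ) *
      jTheta (1/2) (1/2) ζ τ / jTheta (1/2) (1/2) (ξ + ζ) τ) •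
    ∑ α : Fin N × Fin N, Wcoef N α ξ ζ τ • (Imat N α ⊗ₖ (Imat N α)⁻¹)

/-- the Belavin R-matrix `R(z)`, as a function of `ξ` with `z = eπ ξ`. -/
def Rmat (N : ℕ) (ξ ζ τ : ℂ) : Matrix (Fin N × Fin N) (Fin N × Fin N) ℂ :=
  (gHalf N ⊗ₖ gHalf N) * Zmat N ξ ζ τ * (gHalf N ⊗ₖ gHalf N)⁻¹

/-- genericity: every theta-function value and κ-value appearing in a denominator is nonzero. -/
def Rgeneric (N : ℕ) (ξ ζ τ : ℂ) : Prop :=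
  jTheta (1/2) (1/2) (ξ + ζ) τ ≠ 0 ∧
  (∀ α : Fin N × Fin N,
    jTheta (1/2 + (α.1 : ℕ) / N) (1/2 + (α.2 : ℕ) / N) (ζ / N) τ ≠ 0) ∧
  kappaDen N ξ ζ τ ≠ 0

/-- the flip (permutation) operator `P` on `ℂ^N ⊗ ℂ^N`. -/
def Pflip (N : ℕ) : Matrix (Fin N × Fin N) (Fin N × Fin N) ℂ :=
  Matrix.of fun a b => if a.1 = b.2 ∧ a.2 = b.1 then 1 else 0

/-- partial transposition in the second tensor factor. -/
def pt2 {N : ℕ} (M : Matrix (Fin N × Fin N) (Fin N × Fin N) ℂ) :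
    Matrix (Fin N × Fin N) (Fin N × Fin N) ℂ :=
  Matrix.of fun a b => M (a.1, b.2) (b.1, a.2)

/-- `τ_N` evaluated at `eπ u` (all fractional powers via exponentials). -/
def tauNe (N : ℕ) (ζ u : ℂ) : ℂ :=
  eπ (u * (2 / N - 2)) * ThetaF (eπ (2 * N * ζ)) (eπ (ζ + 2 * u)) /
    ThetaF (eπ (2 * N * ζ)) (eπ (ζ - 2 * u))

/-- the normalized Belavin R-matrix `R̂(z) = τ_N(q^{1/2}z⁻¹) R(z)`, as a function of `ξ`. -/
def Rhat (N : ℕ) (ξ ζ τ : ℂ) : Matrix (Fin N × Fin N) (Fin N × Fin N) ℂ :=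
  tauNe N ζ (ζ / 2 - ξ) • Rmat N ξ ζ τ


/-- `M` acting on tensor factors `i` and `j` of a multiple tensor product and as
the identity on the remaining factors. -/
def act2 {N : ℕ} {ι : Type} [Fintype ι] [DecidableEq ι] (i j : ι)
    (M : Matrix (Fin N × Fin N) (Fin N × Fin N) ℂ) :
    Matrix (ι → Fin N) (ι → Fin N) ℂ :=
  Matrix.of fun a b =>
    (if ∀ l, l ≠ i → l ≠ j → a l = b l then 1 else 0) * M (a i, a j) (b i, b j)

/-- the antisymmetrizer `A_k` acting on the factors `1,…,k` of `(ℂ^N)^{⊗(k+1)}`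
(labelled `1,…,k,0`, factor `0` being the last one) and as the identity on factor `0`. -/
def asymExt (N k : ℕ) : Matrix (Fin (k+1) → Fin N) (Fin (k+1) → Fin N) ℂ :=
  (k.factorial : ℂ)⁻¹ • ∑ σ : Equiv.Perm (Fin k),
    (((Equiv.Perm.sign σ : ℤ) : ℂ)) •
      Matrix.of (fun a b =>
        if (∀ i : Fin k, a (Fin.castSucc i) = b (Fin.castSucc (σ.symm i))) ∧
            a (Fin.last k) = b (Fin.last k) then (1 : ℂ) else 0)

section helpers1

/-- Horizontal integrals of an entire `1`-periodic function do not depend on the height. -/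
lemma integral_shift_eq (G : ℂ → ℂ) (hG : Differentiable ℂ G) (hper : ∀ x, G (x + 1) = G x)
    (τ : ℂ) : (∫ x : ℝ in (0:ℝ)..1, G (x + τ)) = ∫ x : ℝ in (0:ℝ)..1, G x := by
  have h1 := Complex.integral_boundary_rect_eq_zero_of_differentiableOn G 0 (1 + τ.im * I)
    hG.differentiableOn
  simp only [zero_re, zero_im, add_re, one_re, mul_re, ofReal_re, I_re, ofReal_im, I_im, add_im,
    one_im, mul_im, mul_zero, mul_one, zero_mul, sub_zero, add_zero, zero_add, ofReal_zero,
    ofReal_one] at h1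
  have h2 : ∀ y : ℝ, G (1 + y * I) = G (y * I) := by
    intro y; rw [add_comm, hper]
  simp only [h2] at h1
  have h3 : (∫ x : ℝ in (0:ℝ)..1, G (x + τ.im * I)) = ∫ x : ℝ in (0:ℝ)..1, G x := by
    linear_combination -h1
  rw [← h3]
  have hp : Function.Periodic (fun x : ℝ => G (x + τ.im * I)) 1 := by
    intro x
    simp only
    rw [← hper (x + τ.im * I)]
    push_cast; ring_nf
  have h4 := hp.intervalIntegral_add_eq 0 τ.re
  simp only [zero_add] at h4
  rw [h4]
  rw [show τ.re + 1 = 1 + τ.re by ring]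
  have h5 := intervalIntegral.integral_comp_add_right (a := 0) (b := 1)
    (fun x : ℝ => G (x + τ.im * I)) τ.re
  rw [zero_add] at h5
  rw [← h5]
  congr 1; funext x
  congr 1
  push_cast
  rw [add_assoc, Complex.re_add_im]

/-- An entire `1`-periodic function all of whose Fourier coefficients vanish is zero. -/
lemma eq_zero_of_fourier (f : ℂ → ℂ) (hf : Differentiable ℂ f) (hper : ∀ x, f (x + 1) = f x)
    (h0 : ∀ n : ℤ, (∫ x : ℝ in (0:ℝ)..1, f x * cexp (-(2 * Real.pi * I * n * x))) = 0) :
    ∀ u, f u = 0 := by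
  have : Fact ((0:ℝ) < 1) := ⟨one_pos⟩
  have hp : Function.Periodic (fun x : ℝ => f x) 1 := by
    intro x; simp only; rw [← hper x]; push_cast; rfl
  have hc : Continuous (fun x : ℝ => f x) := hf.continuous.comp continuous_ofReal
  let g : C(AddCircle (1:ℝ), ℂ) := ⟨hp.lift, continuous_coinduced_dom.mpr hc⟩
  have hg : ∀ x : ℝ, g (x : AddCircle (1:ℝ)) = f x := fun x => rfl
  have hz : ∀ n, fourierCoeff g n = 0 := by
    intro n
    rw [fourierCoeff_eq_intervalIntegral _ n 0]
    rw [show ((0:ℝ) + 1) = 1 by norm_num]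
    have : ∀ x : ℝ, fourier (T := 1) (-n) (x : AddCircle (1:ℝ)) • g (x : AddCircle (1:ℝ))
        = f x * cexp (-(2 * Real.pi * I * n * x)) := by
      intro x
      rw [hg, fourier_coe_apply, smul_eq_mul, mul_comm]
      congr 2
      push_cast; ring
    simp only [this, h0]
    simp
  have hs : Summable (fourierCoeff g) := by
    have : fourierCoeff g = fun _ => 0 := funext hz
    rw [this]; exact summable_zero
  have hreal : ∀ x : ℝ, f x = 0 := by
    intro x
    have := has_pointwise_sum_fourier_series_of_summable hs (x : AddCircle (1:ℝ))
    simp only [hz, zero_smul, hg] at this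
    exact this.unique hasSum_zero
  have ha : AnalyticOnNhd ℂ f Set.univ := fun x _ => hf.analyticAt x
  have hfr : ∃ᶠ z in nhdsWithin (0:ℂ) {0}ᶜ, f z = 0 := by
    have ht : Filter.Tendsto (fun x : ℝ => (x : ℂ)) (nhdsWithin 0 {0}ᶜ) (nhdsWithin 0 {0}ᶜ) := by
      apply tendsto_nhdsWithin_of_tendsto_nhds_of_eventually_within
      · have := continuous_ofReal.tendsto (0:ℝ)
        rw [ofReal_zero] at this
        exact this.mono_left nhdsWithin_le_nhds
      · filter_upwards [self_mem_nhdsWithin] with x hx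
        simpa using hx
    exact ht.frequently (Filter.Eventually.frequently (Filter.Eventually.of_forall hreal))
  have := ha.eqOn_zero_of_preconnected_of_frequently_eq_zero isPreconnected_univ
    (Set.mem_univ 0) hfr
  intro u; exact this (Set.mem_univ u)

/-- Quasi-periodic entire functions of order `d` whose Fourier coefficients of index
`0, …, d-1` vanish are zero. -/
lemma qp_eq_zero (d : ℕ) (hd : 0 < d) (τ lam mu : ℂ) (hmu : mu ≠ 0)
    (f : ℂ → ℂ) (hf : Differentiable ℂ f)
    (h1 : ∀ u, f (u + 1) = cexp (2 * Real.pi * I * lam) * f u)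
    (h2 : ∀ u, f (u + τ) = mu * cexp (-(2 * Real.pi * I * d * u)) * f u)
    (h0 : ∀ n : ℤ, 0 ≤ n → n < d →
      (∫ x : ℝ in (0:ℝ)..1, f x * cexp (-(2 * Real.pi * I * (lam + n) * x))) = 0) :
    ∀ u, f u = 0 := by
  let c : ℤ → ℂ := fun n => ∫ x : ℝ in (0:ℝ)..1, f x * cexp (-(2 * Real.pi * I * (lam + n) * x))
  have hrec : ∀ n : ℤ, c n = (mu * cexp (-(2 * Real.pi * I * (lam + n) * τ))) * c (n + d) := by
    intro n
    have := integral_shift_eq (fun x => f x * cexp (-(2 * Real.pi * I * (lam + n) * x)))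
      (by fun_prop) (by
        intro x
        simp only [h1]
        have e : cexp (-(2 * Real.pi * I * (lam + n) * (x + 1))) =
            cexp (-(2 * Real.pi * I * lam)) * cexp (-(2 * Real.pi * I * (lam + n) * x)) := by
          have e1 : cexp (-(n * (2 * Real.pi * I))) = 1 := by
            rw [Complex.exp_neg, Complex.exp_int_mul_two_pi_mul_I, inv_one]
          calc _ = cexp (-(2 * Real.pi * I * lam)) * cexp (-(2 * Real.pi * I * (lam + n) * x))
                * cexp (-(n * (2 * Real.pi * I))) := by
                  rw [← Complex.exp_add, ← Complex.exp_add]; congr 1; ring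
            _ = _ := by rw [e1, mul_one]
        rw [e]
        have e2 : cexp (2 * Real.pi * I * lam) * cexp (-(2 * Real.pi * I * lam)) = 1 := by
          rw [← Complex.exp_add]; simp
        linear_combination (f x * cexp (-(2 * Real.pi * I * (lam + n) * x))) * e2) τ
    change _ = c n at this
    rw [← this]
    change _ = _ * ∫ x : ℝ in (0:ℝ)..1, _
    rw [← intervalIntegral.integral_const_mul]
    congr 1; funext x
    simp only [h2]
    have e : cexp (-(2 * Real.pi * I * d * x)) * cexp (-(2 * Real.pi * I * (lam + n) * (x + τ))) =
        cexp (-(2 * Real.pi * I * (lam + n) * τ)) *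
          cexp (-(2 * Real.pi * I * (lam + ((n + d : ℤ) : ℂ)) * x)) := by
      rw [← Complex.exp_add, ← Complex.exp_add]; congr 1; push_cast; ring
    linear_combination (mu * f x) * e
  have hne : ∀ n : ℤ, (mu * cexp (-(2 * Real.pi * I * (lam + n) * τ))) ≠ 0 :=
    fun n => mul_ne_zero hmu (Complex.exp_ne_zero _)
  have hstep : ∀ n, c n = 0 ↔ c (n + d) = 0 := by
    intro n; rw [hrec n]; simp [hmu, Complex.exp_ne_zero]
  have hmul : ∀ (r : ℤ) (k : ℕ), (c r = 0 ↔ c (r + k * d) = 0) ∧ (c r = 0 ↔ c (r - k * d) = 0) := by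
    intro r k
    induction k with
    | zero => simp
    | succ k ih =>
      refine ⟨ih.1.trans ?_, ih.2.trans ?_⟩
      · rw [hstep]; push_cast; ring_nf
      · rw [hstep (r - ((k + 1 : ℕ) : ℤ) * d)]; push_cast; ring_nf
  have hall : ∀ n, c n = 0 := by
    intro n
    have hr := h0 (n % d) (Int.emod_nonneg _ (by omega)) (Int.emod_lt_of_pos _ (by omega))
    change c (n % d) = 0 at hr
    have hn : n = n % d + (n / d) * d := by rw [mul_comm]; exact (Int.emod_add_mul_ediv n d).symm
    rcases le_total 0 (n / (d:ℤ)) with h | h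
    · obtain ⟨k, hk⟩ := Int.eq_ofNat_of_zero_le h
      rw [hn, hk]; exact (hmul _ k).1.1 hr
    · obtain ⟨k, hk⟩ := Int.eq_ofNat_of_zero_le (neg_nonneg.mpr h)
      have : n / (d:ℤ) = -(k:ℤ) := by omega
      rw [hn, this, neg_mul, ← sub_eq_add_neg]; exact (hmul _ k).2.1 hr
  have hfin := eq_zero_of_fourier (fun u => f u * cexp (-(2 * Real.pi * I * lam * u)))
    (by fun_prop) (by
      intro x
      simp only [h1]
      have e2 : cexp (2 * Real.pi * I * lam) * cexp (-(2 * Real.pi * I * lam * (x + 1)))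
          = cexp (-(2 * Real.pi * I * lam * x)) := by
        rw [← Complex.exp_add]; congr 1; ring
      linear_combination f x * e2) (by
      intro n
      rw [← hall n]
      change _ = ∫ x : ℝ in (0:ℝ)..1, _
      congr 1; funext x
      rw [mul_assoc, ← Complex.exp_add]
      congr 2; ring)
  intro u
  have := hfin u
  simpa [Complex.exp_ne_zero] using this

lemma qp_integrable (f : ℂ → ℂ) (hf : Differentiable ℂ f) (l : ℂ) :
    IntervalIntegrable (fun x : ℝ => f x * cexp (-(2 * Real.pi * I * l * x)))
      MeasureTheory.volume 0 1 := by
  apply Continuous.intervalIntegrable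
  have := hf.continuous
  fun_prop

/-- order one: uniqueness up to scalar -/
lemma qp_one (τ lam mu : ℂ) (hmu : mu ≠ 0) (f g : ℂ → ℂ)
    (hf : Differentiable ℂ f) (hg : Differentiable ℂ g)
    (f1 : ∀ u, f (u + 1) = cexp (2 * Real.pi * I * lam) * f u)
    (f2 : ∀ u, f (u + τ) = mu * cexp (-(2 * Real.pi * I * u)) * f u)
    (g1 : ∀ u, g (u + 1) = cexp (2 * Real.pi * I * lam) * g u)
    (g2 : ∀ u, g (u + τ) = mu * cexp (-(2 * Real.pi * I * u)) * g u) (u v : ℂ) :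
    f u * g v = f v * g u := by
  let c : (ℂ → ℂ) → ℂ := fun f => ∫ x : ℝ in (0:ℝ)..1, f x * cexp (-(2 * Real.pi * I * lam * x))
  have key : ∀ F : ℂ → ℂ, Differentiable ℂ F →
      (∀ u, F (u + 1) = cexp (2 * Real.pi * I * lam) * F u) →
      (∀ u, F (u + τ) = mu * cexp (-(2 * Real.pi * I * u)) * F u) → c F = 0 → ∀ u, F u = 0 := by
    intro F hF F1 F2 F0
    apply qp_eq_zero 1 one_pos τ lam mu hmu F hF F1 (by simpa using F2)
    intro n hn hn1
    have : n = 0 := by simp at hn1; omega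
    subst this
    simpa using F0
  by_cases hc : c g = 0
  · have := key g hg g1 g2 hc
    simp [this]
  · have := key (fun u => c g * f u - c f * g u) (by fun_prop)
      (fun u => by simp only [f1, g1]; ring) (fun u => by simp only [f2, g2]; ring) (by
        change (∫ x : ℝ in (0:ℝ)..1, _) = 0
        have e : ∀ x : ℝ, (c g * f x - c f * g x) * cexp (-(2 * Real.pi * I * lam * x)) =
          c g * (f x * cexp (-(2 * Real.pi * I * lam * x))) -
          c f * (g x * cexp (-(2 * Real.pi * I * lam * x))) := fun x => by ring
        simp only [e]
        rw [intervalIntegral.integral_sub ((qp_integrable f hf lam).const_mul _)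
          ((qp_integrable g hg lam).const_mul _), intervalIntegral.integral_const_mul,
          intervalIntegral.integral_const_mul]
        change c g * c f - c f * c g = 0
        ring)
    have hu := this u
    have hv := this v
    apply mul_left_cancel₀ hc
    linear_combination g v * hu - g u * hv

/-- order two: a function vanishing at two generic points is zero -/
lemma qp_two (τ lam mu : ℂ) (hmu : mu ≠ 0) (f g k : ℂ → ℂ)
    (hf : Differentiable ℂ f) (hg : Differentiable ℂ g) (hk : Differentiable ℂ k)
    (f1 : ∀ u, f (u + 1) = cexp (2 * Real.pi * I * lam) * f u)
    (f2 : ∀ u, f (u + τ) = mu * cexp (-(2 * Real.pi * I * 2 * u)) * f u)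
    (g1 : ∀ u, g (u + 1) = cexp (2 * Real.pi * I * lam) * g u)
    (g2 : ∀ u, g (u + τ) = mu * cexp (-(2 * Real.pi * I * 2 * u)) * g u)
    (k1 : ∀ u, k (u + 1) = cexp (2 * Real.pi * I * lam) * k u)
    (k2 : ∀ u, k (u + τ) = mu * cexp (-(2 * Real.pi * I * 2 * u)) * k u)
    (a b : ℂ) (fa : f a = 0) (fb : f b = 0) (ga : g a = 0) (gb : g b ≠ 0)
    (ka : k a ≠ 0) (kb : k b = 0) (u : ℂ) : f u = 0 := by
  let c : ℤ → (ℂ → ℂ) → ℂ := fun n f =>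
    ∫ x : ℝ in (0:ℝ)..1, f x * cexp (-(2 * Real.pi * I * (lam + n) * x))
  have lin : ∀ (n : ℤ) (x y z : ℂ), c n (fun u => x * f u + y * g u + z * k u) =
      x * c n f + y * c n g + z * c n k := by
    intro n x y z
    change (∫ x : ℝ in (0:ℝ)..1, _) = _
    have e : ∀ t : ℝ, (x * f t + y * g t + z * k t) * cexp (-(2 * Real.pi * I * (lam + n) * t)) =
          x * (f t * cexp (-(2 * Real.pi * I * (lam + n) * t))) +
          y * (g t * cexp (-(2 * Real.pi * I * (lam + n) * t))) +
          z * (k t * cexp (-(2 * Real.pi * I * (lam + n) * t))) := fun x => by ring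
    simp only [e]
    have If := (qp_integrable f hf (lam + n)).const_mul x
    have Ig := (qp_integrable g hg (lam + n)).const_mul y
    have Ik := (qp_integrable k hk (lam + n)).const_mul z
    rw [intervalIntegral.integral_add (If.add Ig) Ik, intervalIntegral.integral_add If Ig,
      intervalIntegral.integral_const_mul, intervalIntegral.integral_const_mul,
      intervalIntegral.integral_const_mul]
  have key : ∀ x y z : ℂ, x * c 0 f + y * c 0 g + z * c 0 k = 0 →
      x * c 1 f + y * c 1 g + z * c 1 k = 0 → ∀ u, x * f u + y * g u + z * k u = 0 := by
    intro x y z h0 h1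
    apply qp_eq_zero 2 two_pos τ lam mu hmu (fun u => x * f u + y * g u + z * k u) (by fun_prop)
      (fun u => by simp only [f1, g1, k1]; ring)
      (fun u => by push_cast; simp only [f2, g2, k2]; ring)
    intro n hn hn1
    have : n = 0 ∨ n = 1 := by push_cast at hn1; omega
    rcases this with rfl | rfl
    · exact (lin 0 x y z).trans h0
    · exact (lin 1 x y z).trans h1
  have hdep : ∃ x y z : ℂ, (x ≠ 0 ∨ y ≠ 0 ∨ z ≠ 0) ∧ x * c 0 f + y * c 0 g + z * c 0 k = 0 ∧
      x * c 1 f + y * c 1 g + z * c 1 k = 0 := by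
    let v : Fin 3 → (Fin 2 → ℂ) := ![![c 0 f, c 1 f], ![c 0 g, c 1 g], ![c 0 k, c 1 k]]
    have : ¬ LinearIndependent ℂ v := by
      intro h
      have := h.fintype_card_le_finrank
      simp at this
    rw [Fintype.not_linearIndependent_iff] at this
    obtain ⟨w, hw, i, hi⟩ := this
    refine ⟨w 0, w 1, w 2, ?_, ?_, ?_⟩
    · fin_cases i
      · left; exact hi
      · right; left; exact hi
      · right; right; exact hi
    · have := congrFun hw 0
      simpa [Fin.sum_univ_three, v] using this
    · have := congrFun hw 1
      simpa [Fin.sum_univ_three, v] using this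
  obtain ⟨x, y, z, hxyz, e0, e1⟩ := hdep
  have hz := key x y z e0 e1
  have z0 : z = 0 := by
    have := hz a
    simpa [fa, ga, ka] using this
  have y0 : y = 0 := by
    have := hz b
    simpa [fb, gb, kb] using this
  have x0 : x ≠ 0 := by
    rcases hxyz with h | h | h
    · exact h
    · exact absurd y0 h
    · exact absurd z0 h
  have := hz u
  simpa [z0, y0, x0] using this

end helpers1

section helpers2

lemma jTheta_eq (a b : ℝ) (u τ : ℂ) : jTheta a b u τ =
    cexp (Real.pi * I * a ^ 2 * τ + 2 * Real.pi * I * a * (u + b)) *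
      jacobiTheta₂ (u + b + a * τ) τ := by
  rw [jTheta, jacobiTheta₂, ← tsum_mul_left]
  refine tsum_congr fun m => ?_
  rw [jacobiTheta₂_term, ← Complex.exp_add]
  congr 1; ring

lemma jTheta_differentiable (a b : ℝ) {τ : ℂ} (hτ : 0 < τ.im) :
    Differentiable ℂ (fun u => jTheta a b u τ) := by
  simp only [jTheta_eq]
  intro u
  apply DifferentiableAt.mul (by fun_prop)
  exact (differentiableAt_jacobiTheta₂_fst (u + b + a * τ) hτ).comp u
    (f := fun u => u + b + a * τ) (by fun_prop)

lemma jTheta_add_one (a b : ℝ) (u τ : ℂ) :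
    jTheta a b (u + 1) τ = cexp (2 * Real.pi * I * a) * jTheta a b u τ := by
  rw [jTheta_eq, jTheta_eq, show u + 1 + b + a * τ = (u + b + a * τ) + 1 by ring,
    jacobiTheta₂_add_left, ← mul_assoc, ← Complex.exp_add]
  congr 2; ring

lemma jTheta_add_tau (a b : ℝ) (u τ : ℂ) :
    jTheta a b (u + τ) τ =
      cexp (-(Real.pi * I * τ) - 2 * Real.pi * I * (u + b)) * jTheta a b u τ := by
  rw [jTheta_eq, jTheta_eq, show u + τ + b + a * τ = (u + b + a * τ) + τ by ring,
    jacobiTheta₂_add_left', ← mul_assoc, ← mul_assoc, ← Complex.exp_add, ← Complex.exp_add]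
  congr 2; ring

lemma jTheta_add_real (a b c : ℝ) (u τ : ℂ) :
    jTheta a b (u + c) τ = jTheta a (b + c) u τ := by
  simp only [jTheta]
  refine tsum_congr fun m => ?_
  congr 1; push_cast; ring

lemma jTheta_add_mul_tau (a b c : ℝ) (u τ : ℂ) :
    jTheta a b (u + c * τ) τ =
      cexp (-(Real.pi * I * c ^ 2 * τ) - 2 * Real.pi * I * c * (u + b)) *
        jTheta (a + c) b u τ := by
  rw [jTheta_eq, jTheta_eq, ← mul_assoc, ← Complex.exp_add]
  congr 2
  · push_cast; ring
  · push_cast; ring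

lemma jTheta_char1 (a b : ℝ) (n : ℤ) (u τ : ℂ) : jTheta (a + n) b u τ = jTheta a b u τ := by
  simp only [jTheta]
  rw [← (Equiv.addRight n).tsum_eq (fun m : ℤ => cexp (Real.pi * I * ((m : ℂ) + (a : ℂ)) ^ 2 * τ +
    2 * Real.pi * I * ((m : ℂ) + (a : ℂ)) * (u + (b : ℂ))))]
  refine tsum_congr fun m => ?_
  simp only [Equiv.coe_addRight]
  push_cast
  congr 1; ring

lemma jTheta_char2 (a b : ℝ) (n : ℤ) (u τ : ℂ) :
    jTheta a (b + n) u τ = cexp (2 * Real.pi * I * a * n) * jTheta a b u τ := by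
  simp only [jTheta]
  rw [← tsum_mul_left]
  refine tsum_congr fun m => ?_
  have e1 : cexp ((m * n : ℤ) * (2 * Real.pi * I)) = 1 := Complex.exp_int_mul_two_pi_mul_I _
  calc _ = cexp (2 * Real.pi * I * a * n) * cexp (Real.pi * I * ((m : ℂ) + (a : ℂ)) ^ 2 * τ +
    2 * Real.pi * I * ((m : ℂ) + (a : ℂ)) * (u + (b : ℂ))) * cexp ((m * n : ℤ) * (2 * Real.pi * I)) := by
        rw [← Complex.exp_add, ← Complex.exp_add]; congr 1; push_cast; ring
    _ = _ := by rw [e1, mul_one]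

lemma jTheta_neg (a b : ℝ) (u τ : ℂ) : jTheta a b (-u) τ = jTheta (-a) (-b) u τ := by
  simp only [jTheta]
  rw [← (Equiv.neg ℤ).tsum_eq]
  refine tsum_congr fun m => ?_
  simp only [Equiv.neg_apply]
  push_cast
  congr 1; ring

variable {N : ℕ} [NeZero N]

/-- theta functions with characteristics in `(ZMod N)²` -/
def TT (τ : ℂ) (m k : ZMod N) (u : ℂ) : ℂ :=
  jTheta (1/2 + (m.val : ℝ) / N) (1/2 + (k.val : ℝ) / N) u τ

/-- the standard additive character -/
abbrev ee (m : ZMod N) : ℂ := ZMod.stdAddChar m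

lemma ee_val (m : ZMod N) : ee m = cexp (2 * Real.pi * I * (m.val : ℂ) / N) := by
  have := ZMod.stdAddChar_coe (N := N) (m.val : ℤ)
  rw [← ZMod.natCast_zmod_val m]
  rw [ZMod.natCast_zmod_val m]
  simpa using this

lemma ee_add (m n : ZMod N) : ee (m + n) = ee m * ee n := AddChar.map_add_eq_mul _ _ _

lemma ee_zero : ee (0 : ZMod N) = 1 := AddChar.map_zero_eq_one _

lemma ee_ne (m : ZMod N) : ee m ≠ 0 := by rw [ee_val]; exact Complex.exp_ne_zero _

lemma ee_neg (m : ZMod N) : ee (-m) = (ee m)⁻¹ := AddChar.map_neg_eq_inv _ _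

lemma exp_pi_I' : cexp (Real.pi * I) = -1 := Complex.exp_pi_mul_I

lemma NC : (N : ℂ) ≠ 0 := Nat.cast_ne_zero.mpr (NeZero.ne N)
lemma NR : (N : ℝ) ≠ 0 := Nat.cast_ne_zero.mpr (NeZero.ne N)

lemma TT_diff {τ : ℂ} (hτ : 0 < τ.im) (m k : ZMod N) : Differentiable ℂ (TT τ m k) :=
  jTheta_differentiable _ _ hτ

lemma TT_add_one (τ : ℂ) (m k : ZMod N) (u : ℂ) : TT τ m k (u + 1) = - ee m * TT τ m k u := by
  rw [TT, jTheta_add_one, TT, ee_val]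
  congr 1
  rw [← neg_one_mul, ← exp_pi_I', ← Complex.exp_add]
  congr 1; push_cast; ring

lemma TT_add_tau (τ : ℂ) (m k : ZMod N) (u : ℂ) : TT τ m k (u + τ) =
    - cexp (-(Real.pi * I * τ) - 2 * Real.pi * I * u) * ee (-k) * TT τ m k u := by
  rw [TT, jTheta_add_tau, TT, ee_neg, ee_val, ← Complex.exp_neg]
  congr 1
  have e : ∀ x : ℂ, -x = cexp (-(Real.pi * I)) * x := by
    intro x; rw [Complex.exp_neg, exp_pi_I']; norm_num
  rw [e (cexp _), ← Complex.exp_add, ← Complex.exp_add]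
  congr 1; push_cast; ring

/-- the phase in the shift by `1/N` -/
def ph2 (m k : ZMod N) : ℂ := if k + 1 = 0 then - ee m else 1

lemma val_add_one_of_ne (k : ZMod N) (h : k + 1 ≠ 0) : (k + 1).val = k.val + 1 := by
  have hk := k.val_lt
  have h1 : k + 1 = ((k.val + 1 : ℕ) : ZMod N) := by simp
  have h2 : k.val + 1 ≠ N := by
    intro h3; apply h; rw [h1, h3]; simp
  rw [h1, ZMod.val_natCast_of_lt (by omega)]

lemma val_of_add_one_eq (k : ZMod N) (h : k + 1 = 0) : k.val + 1 = N := by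
  have hk := k.val_lt
  have h1 : k + 1 = ((k.val + 1 : ℕ) : ZMod N) := by simp
  rw [h1, ZMod.natCast_eq_zero_iff] at h
  have := Nat.le_of_dvd (by omega) h
  omega

lemma TT_add_inv (τ : ℂ) (m k : ZMod N) (u : ℂ) :
    TT τ m k (u + 1 / N) = ph2 m k * TT τ m (k + 1) u := by
  have e : (1 / N : ℂ) = ((1 / N : ℝ) : ℂ) := by push_cast; rfl
  rw [TT, e, jTheta_add_real, ph2, TT]
  have hN := NR (N := N)
  split_ifs with h
  · have hv := val_of_add_one_eq k h
    have hv' : (k.val : ℝ) = N - 1 := by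
      rw [eq_sub_iff_add_eq]; exact_mod_cast hv
    rw [h, ZMod.val_zero, show (1/2 + (k.val : ℝ) / N + 1 / N) = (1/2 + ((0 : ℕ) : ℝ) / N) + (1 : ℤ) by
      rw [hv']; push_cast; field_simp; ring, jTheta_char2]
    congr 1
    rw [ee_val, ← neg_one_mul, ← exp_pi_I', ← Complex.exp_add]
    congr 1; push_cast; ring
  · rw [val_add_one_of_ne k h, one_mul]
    congr 1; push_cast; ring

/-- the phase in the shift by `τ/N` -/
def ph1 (τ : ℂ) (k : ZMod N) : ℂ :=
  cexp (-(Real.pi * I * τ / N ^ 2) - 2 * Real.pi * I / N * (1/2 + (k.val : ℂ) / N))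

lemma TT_add_tau_div (τ : ℂ) (m k : ZMod N) (u : ℂ) :
    TT τ m k (u + τ / N) = ph1 τ k * cexp (-(2 * Real.pi * I * u / N)) * TT τ (m + 1) k u := by
  have e : (τ / N : ℂ) = ((1 / N : ℝ) : ℂ) * τ := by push_cast; ring
  rw [TT, e, jTheta_add_mul_tau, ph1, TT, ← Complex.exp_add]
  have hN := NR (N := N)
  have h3 : jTheta (1/2 + (m.val : ℝ) / N + 1 / N) (1/2 + (k.val : ℝ) / N) u τ =
      jTheta (1/2 + ((m+1).val : ℝ) / N) (1/2 + (k.val : ℝ) / N) u τ := by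
    by_cases h : m + 1 = 0
    · have hv := val_of_add_one_eq m h
      have hv' : (m.val : ℝ) = N - 1 := by
        rw [eq_sub_iff_add_eq]; exact_mod_cast hv
      rw [h, ZMod.val_zero, show (1/2 + (m.val : ℝ) / N + 1 / N) =
        (1/2 + ((0 : ℕ) : ℝ) / N) + (1 : ℤ) by
        rw [hv']; push_cast; field_simp; ring, jTheta_char1]
    · rw [val_add_one_of_ne m h]
      congr 1; push_cast; ring
  rw [h3]
  congr 2; push_cast; ring

lemma TT_zero_neg (τ : ℂ) (u : ℂ) : TT τ (0 : ZMod N) 0 (-u) = - TT τ (0 : ZMod N) 0 u := by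
  simp only [TT, ZMod.val_zero]
  rw [jTheta_neg]
  rw [show (-(1/2 + ((0:ℕ):ℝ) / N)) = (1/2 + ((0:ℕ):ℝ) / N) + ((-1 : ℤ) : ℝ) by push_cast; ring,
    jTheta_char1, jTheta_char2]
  have e : ∀ x : ℂ, -x = cexp (-(Real.pi * I)) * x := by
    intro x; rw [Complex.exp_neg, exp_pi_I']; norm_num
  rw [e (jTheta _ _ _ _)]
  congr 2; push_cast; ring

lemma TT_zero_zero (τ : ℂ) : TT τ (0 : ZMod N) 0 0 = 0 := by
  have := TT_zero_neg (N := N) τ 0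
  rw [neg_zero] at this
  exact self_eq_neg.mp this

lemma neg_val_char (m : ZMod N) : ∃ n : ℤ, (-(1/2 + (m.val : ℝ) / N)) =
    (1/2 + ((-m).val : ℝ) / N) + n := by
  have hN := NR (N := N)
  by_cases h : m = 0
  · subst h
    refine ⟨-1, ?_⟩
    simp; norm_num
  · have : NeZero m := ⟨h⟩
    refine ⟨-2, ?_⟩
    rw [ZMod.val_neg_of_ne_zero, Nat.cast_sub m.val_lt.le]
    push_cast; field_simp; ring

lemma TT_neg (τ : ℂ) (m k : ZMod N) : ∃ c : ℂ, c ≠ 0 ∧ ∀ u,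
    TT τ m k (-u) = c * TT τ (-m) (-k) u := by
  obtain ⟨n, hn⟩ := neg_val_char m
  obtain ⟨n', hn'⟩ := neg_val_char k
  refine ⟨cexp (2 * Real.pi * I * (1/2 + ((-m).val : ℝ) / N : ℝ) * n'), Complex.exp_ne_zero _, ?_⟩
  intro u
  rw [TT, jTheta_neg, hn, hn', jTheta_char1, jTheta_char2, TT]

lemma sum_val : (∑ m : ZMod N, (m.val : ℂ)) * 2 = N * (N - 1) := by
  have h1 : (∑ m : ZMod N, (m.val : ℂ)) = ∑ i ∈ Finset.range N, (i : ℂ) := by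
    obtain ⟨n, rfl⟩ := Nat.exists_eq_succ_of_ne_zero (NeZero.ne N)
    rw [Finset.sum_range]
    rfl
  rw [h1]
  have := Finset.sum_range_id_mul_two N
  have h2 : ((∑ i ∈ Finset.range N, i : ℕ) : ℂ) * 2 = ((N * (N - 1) : ℕ) : ℂ) := by
    rw [← this]; push_cast; rfl
  push_cast at h2
  rw [h2, Nat.cast_sub (NeZero.one_le)]
  simp

lemma exp_sum_half : cexp (2 * Real.pi * I * ∑ m : ZMod N, (1/2 + (m.val : ℂ) / N)) = -1 := by
  have h : (∑ m : ZMod N, (1/2 + (m.val : ℂ) / N)) = N - 1 / 2 := by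
    rw [Finset.sum_add_distrib, ← Finset.sum_div Finset.univ (fun m : ZMod N => (m.val : ℂ))]
    simp only [Finset.sum_const, Finset.card_univ, ZMod.card, nsmul_eq_mul]
    have hN := NC (N := N)
    have h1 : (∑ m : ZMod N, (m.val : ℂ)) = N * (N - 1) / 2 := by
      rw [← sum_val]; ring
    rw [h1]
    field_simp; ring
  rw [h, show 2 * Real.pi * I * ((N : ℂ) - 1/2) = (N : ℤ) * (2 * Real.pi * I) + -(Real.pi * I) by
    push_cast; ring, Complex.exp_add, Complex.exp_int_mul_two_pi_mul_I, Complex.exp_neg, exp_pi_I']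
  norm_num

lemma prod_ph2 : (∏ α : ZMod N × ZMod N, ph2 α.1 α.2) = -1 := by
  rw [Fintype.prod_prod_type]
  have h1 : ∀ m : ZMod N, (∏ k : ZMod N, ph2 m k) = - ee m := by
    intro m
    rw [Finset.prod_eq_single (-1)]
    · simp [ph2]
    · intro b _ hb
      rw [ph2, if_neg]
      intro h; apply hb; exact eq_neg_of_add_eq_zero_left h
    · simp
  simp only [h1]
  rw [← exp_sum_half (N := N), Finset.mul_sum, Complex.exp_sum]
  refine Finset.prod_congr rfl fun m _ => ?_
  rw [ee_val, ← neg_one_mul, ← exp_pi_I', ← Complex.exp_add]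
  congr 1; ring

lemma prod_ph1 (τ : ℂ) : (∏ α : ZMod N × ZMod N, ph1 τ α.2) = - cexp (-(Real.pi * I * τ)) := by
  have hN := NC (N := N)
  have e : (-1 : ℂ) = (-1 : ℂ)⁻¹ := by norm_num
  rw [Fintype.prod_prod_type, ← neg_one_mul, e, ← exp_sum_half (N := N), ← Complex.exp_neg,
    ← Complex.exp_add]
  simp only [ph1]
  rw [Finset.prod_const, ← Complex.exp_sum, ← Complex.exp_nat_mul]
  simp only [Finset.sum_sub_distrib, ← Finset.mul_sum, Finset.card_univ, ZMod.card, Finset.sum_const]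
  congr 1
  rw [nsmul_eq_mul]
  field_simp
  ring

end helpers2

section helpers3

variable {N : ℕ} [NeZero N]

lemma exists_exp_eq (L : ℂ) (hL : L ≠ 0) : ∃ lam : ℂ, cexp (2 * Real.pi * I * lam) = L := by
  refine ⟨Complex.log L / (2 * Real.pi * I), ?_⟩
  rw [mul_div_cancel₀ _ Complex.two_pi_I_ne_zero, Complex.exp_log hL]

/-- products of shifted theta functions -/
def DD (τ : ℂ) (α : ZMod N × ZMod N) (ξ u : ℂ) : ℂ :=
  ∏ β : ZMod N × ZMod N, TT τ β.1 β.2 ((if β = α then ξ else 0) + u / N)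

lemma DD_diff {τ : ℂ} (hτ : 0 < τ.im) (α : ZMod N × ZMod N) (ξ : ℂ) :
    Differentiable ℂ (DD τ α ξ) := by
  unfold DD
  apply Differentiable.fun_finsetProd
  intro β _
  exact (TT_diff hτ β.1 β.2).comp (f := fun u : ℂ => (if β = α then ξ else 0) + u / N)
    (by fun_prop)

lemma DD_add_one (τ : ℂ) (α : ZMod N × ZMod N) (ξ u : ℂ) :
    DD τ α ξ (u + 1) = - DD τ (α + (0, 1)) ξ u := by
  unfold DD
  have h : ∀ β : ZMod N × ZMod N, TT τ β.1 β.2 ((if β = α then ξ else 0) + (u + 1) / N) =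
      ph2 β.1 β.2 * TT τ β.1 (β.2 + 1) ((if β = α then ξ else 0) + u / N) := by
    intro β
    rw [← TT_add_inv]; congr 1; ring
  simp only [h]
  rw [Finset.prod_mul_distrib, prod_ph2, neg_one_mul]
  congr 1
  conv_rhs => rw [← Equiv.prod_comp (Equiv.addRight ((0, 1) : ZMod N × ZMod N))]
  refine Finset.prod_congr rfl fun β _ => ?_
  simp

lemma DD_add_tau (τ : ℂ) (α : ZMod N × ZMod N) (ξ u : ℂ) :
    DD τ α ξ (u + τ) = - cexp (-(Real.pi * I * τ)) * cexp (-(2 * Real.pi * I * (ξ / N + u))) *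
      DD τ (α + (1, 0)) ξ u := by
  unfold DD
  have hN := NC (N := N)
  have h : ∀ β : ZMod N × ZMod N, TT τ β.1 β.2 ((if β = α then ξ else 0) + (u + τ) / N) =
      ph1 τ β.2 * cexp (-(2 * Real.pi * I / N * ((if β = α then ξ else 0) + u / N))) *
        TT τ (β.1 + 1) β.2 ((if β = α then ξ else 0) + u / N) := by
    intro β
    rw [show ((if β = α then ξ else 0) + (u + τ) / N) =
      ((if β = α then ξ else 0) + u / N) + τ / N by ring, TT_add_tau_div]
    congr 3; ring
  simp only [h]
  rw [Finset.prod_mul_distrib, Finset.prod_mul_distrib, prod_ph1, ← Complex.exp_sum]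
  congr 1
  · congr 2
    rw [Finset.sum_neg_distrib, ← Finset.mul_sum, Finset.sum_add_distrib]
    simp only [Finset.sum_ite_eq', Finset.mem_univ, if_true, Finset.sum_const, Finset.card_univ,
      Fintype.card_prod, ZMod.card, nsmul_eq_mul]
    push_cast
    field_simp
  · conv_rhs => rw [← Equiv.prod_comp (Equiv.addRight ((1, 0) : ZMod N × ZMod N))]
    refine Finset.prod_congr rfl fun β _ => ?_
    simp

/-- the finite Fourier transform, before division -/
def FF (τ : ℂ) (γ : ZMod N × ZMod N) (ξ u : ℂ) : ℂ :=
  ∑ α : ZMod N × ZMod N, ee (α.1 * γ.2 - α.2 * γ.1) * DD τ α ξ u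

lemma FF_add_one (τ : ℂ) (γ : ZMod N × ZMod N) (ξ u : ℂ) :
    FF τ γ ξ (u + 1) = - ee γ.1 * FF τ γ ξ u := by
  unfold FF
  conv_rhs => rw [← Equiv.sum_comp (Equiv.addRight ((0, 1) : ZMod N × ZMod N))]
  rw [Finset.mul_sum]
  refine Finset.sum_congr rfl fun α _ => ?_
  simp only [Equiv.coe_addRight, DD_add_one, Prod.fst_add, Prod.snd_add, add_zero]
  rw [show α.1 * γ.2 - α.2 * γ.1 = γ.1 + (α.1 * γ.2 - (α.2 + 1) * γ.1) by ring, ee_add]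
  ring

lemma FF_add_tau (τ : ℂ) (γ : ZMod N × ZMod N) (ξ u : ℂ) :
    FF τ γ ξ (u + τ) = - cexp (-(Real.pi * I * τ)) * cexp (-(2 * Real.pi * I * (ξ / N + u))) *
      ee (-γ.2) * FF τ γ ξ u := by
  unfold FF
  conv_rhs => rw [← Equiv.sum_comp (Equiv.addRight ((1, 0) : ZMod N × ZMod N))]
  rw [Finset.mul_sum]
  refine Finset.sum_congr rfl fun α _ => ?_
  simp only [Equiv.coe_addRight, DD_add_tau, Prod.fst_add, Prod.snd_add, add_zero]
  rw [show α.1 * γ.2 - α.2 * γ.1 = -γ.2 + ((α.1 + 1) * γ.2 - α.2 * γ.1) by ring, ee_add]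
  ring

lemma FF_eq {τ : ℂ} (hτ : 0 < τ.im) (γ : ZMod N × ZMod N) (ξ u : ℂ) :
    FF τ γ ξ u * TT τ γ.1 γ.2 (ξ / N) = FF τ γ ξ 0 * TT τ γ.1 γ.2 (u + ξ / N) := by
  obtain ⟨lam, hlam⟩ := exists_exp_eq (- ee γ.1) (neg_ne_zero.mpr (ee_ne _))
  have := qp_one τ lam (- cexp (-(Real.pi * I * τ)) * cexp (-(2 * Real.pi * I * (ξ / N))) *
      ee (-γ.2))
    (mul_ne_zero (mul_ne_zero (neg_ne_zero.mpr (Complex.exp_ne_zero _)) (Complex.exp_ne_zero _))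
      (ee_ne _))
    (FF τ γ ξ) (fun u => TT τ γ.1 γ.2 (u + ξ / N))
    (by
      unfold FF
      apply Differentiable.fun_sum
      intro α _
      exact (DD_diff hτ α ξ).const_mul _)
    ((TT_diff hτ γ.1 γ.2).comp (f := fun u : ℂ => u + ξ / N) (by fun_prop))
    (by intro u; rw [hlam, FF_add_one])
    (by
      intro u; rw [FF_add_tau, mul_add, neg_add, Complex.exp_add]; ring)
    (by intro u; rw [hlam, ← TT_add_one]; congr 1; ring)
    (by
      intro u
      rw [show u + τ + ξ / N = (u + ξ / N) + τ by ring, TT_add_tau, sub_eq_add_neg,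
        Complex.exp_add, mul_add, neg_add, Complex.exp_add]; ring) u 0
  simpa using this

lemma Pi_eq {τ : ℂ} (hτ : 0 < τ.im) (u v : ℂ) :
    DD τ (0 : ZMod N × ZMod N) 0 u * TT τ (0 : ZMod N) 0 v =
      DD τ (0 : ZMod N × ZMod N) 0 v * TT τ (0 : ZMod N) 0 u := by
  obtain ⟨lam, hlam⟩ := exists_exp_eq (- ee (0 : ZMod N)) (neg_ne_zero.mpr (ee_ne _))
  have hD : ∀ α β : ZMod N × ZMod N, ∀ u, DD τ α 0 u = DD τ β 0 u := by
    intro α β u; simp [DD]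
  exact qp_one τ lam (- cexp (-(Real.pi * I * τ)))
    (neg_ne_zero.mpr (Complex.exp_ne_zero _))
    (DD τ (0 : ZMod N × ZMod N) 0) (TT τ (0 : ZMod N) 0) (DD_diff hτ _ _) (TT_diff hτ _ _)
    (by intro u; rw [hlam, DD_add_one, hD _ 0, ee_zero]; ring)
    (by intro u; rw [DD_add_tau, hD _ 0]; simp)
    (by intro u; rw [hlam, TT_add_one])
    (by intro u; rw [TT_add_tau, sub_eq_add_neg, Complex.exp_add, neg_zero, ee_zero]; ring) u v

/-- the product of theta constants -/
def KK (N : ℕ) [NeZero N] (τ : ℂ) : ℂ :=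
  ∏ β ∈ (Finset.univ : Finset (ZMod N × ZMod N)).erase 0, TT τ β.1 β.2 0

lemma FF_zero (τ : ℂ) (γ : ZMod N × ZMod N) (ξ : ℂ) :
    FF τ γ ξ 0 = KK N τ * TT τ (0 : ZMod N) 0 ξ := by
  unfold FF
  rw [Finset.sum_eq_single 0]
  · simp only [Prod.fst_zero, Prod.snd_zero, zero_mul, sub_zero]
    rw [ee_zero, one_mul, DD, ← Finset.prod_erase_mul _ _ (Finset.mem_univ 0)]
    congr 1
    · refine Finset.prod_congr rfl fun β hβ => ?_
      rw [if_neg (Finset.ne_of_mem_erase hβ)]; simp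
    · simp
  · intro α _ hα
    rw [DD, Finset.prod_eq_zero (Finset.mem_univ 0), mul_zero]
    rw [if_neg hα.symm]
    simpa using TT_zero_zero (N := N) τ
  · simp

/-- ratios of theta functions -/
def rr (τ ζ : ℂ) (α : ZMod N × ZMod N) (ξ : ℂ) : ℂ :=
  TT τ α.1 α.2 (ξ + ζ / N) / TT τ α.1 α.2 (ζ / N)

section dual
variable {τ ζ : ℂ} (hτ : 0 < τ.im) (hne : ∀ α : ZMod N × ZMod N, TT τ α.1 α.2 (ζ / N) ≠ 0)

lemma DD_eq_rr (hne : ∀ α : ZMod N × ZMod N, TT τ α.1 α.2 (ζ / N) ≠ 0)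
    (α : ZMod N × ZMod N) (ξ : ℂ) :
    DD τ α ξ ζ = rr τ ζ α ξ * DD τ (0 : ZMod N × ZMod N) 0 ζ := by
  unfold DD
  rw [← Finset.prod_erase_mul _ _ (Finset.mem_univ α),
    ← Finset.prod_erase_mul Finset.univ (fun β : ZMod N × ZMod N => TT τ β.1 β.2
      ((if β = (0 : ZMod N × ZMod N) then (0:ℂ) else 0) + ζ / N)) (Finset.mem_univ α)]
  have h1 : ∏ x ∈ Finset.univ.erase α, TT τ x.1 x.2 ((if x = α then ξ else 0) + ζ / N) =
      ∏ x ∈ Finset.univ.erase α, TT τ x.1 x.2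
        ((if x = (0 : ZMod N × ZMod N) then (0:ℂ) else 0) + ζ / N) := by
    refine Finset.prod_congr rfl fun β hβ => ?_
    rw [if_neg (Finset.ne_of_mem_erase hβ)]; simp
  rw [h1]
  simp only [if_true, ite_self, zero_add, rr]
  have := hne α
  field_simp

lemma DD_ne (hne : ∀ α : ZMod N × ZMod N, TT τ α.1 α.2 (ζ / N) ≠ 0) :
    DD τ (0 : ZMod N × ZMod N) 0 ζ ≠ 0 := by
  unfold DD
  rw [Finset.prod_ne_zero_iff]
  intro β _
  simpa using hne β

lemma T0_ne (hτ : 0 < τ.im) (hne : ∀ α : ZMod N × ZMod N, TT τ α.1 α.2 (ζ / N) ≠ 0) :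
    TT τ (0 : ZMod N) 0 ζ ≠ 0 := by
  intro h
  have h1 := Pi_eq (N := N) hτ ζ (ζ / N)
  rw [h, mul_zero] at h1
  rcases mul_eq_zero.mp h1 with h2 | h2
  · exact DD_ne hne h2
  · exact hne 0 h2

/-- the proportionality constant -/
def kap (N : ℕ) [NeZero N] (τ ζ : ℂ) : ℂ :=
  KK N τ * TT τ (0 : ZMod N) 0 ζ / DD τ (0 : ZMod N × ZMod N) 0 ζ

lemma dual_gen (hτ : 0 < τ.im) (hne : ∀ α : ZMod N × ZMod N, TT τ α.1 α.2 (ζ / N) ≠ 0)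
    (γ : ZMod N × ZMod N) (ξ : ℂ) :
    (∑ α : ZMod N × ZMod N, ee (α.1 * γ.2 - α.2 * γ.1) * rr τ ζ α ξ) *
      DD τ (0 : ZMod N × ZMod N) 0 ζ * TT τ γ.1 γ.2 (ξ / N) =
      KK N τ * TT τ (0 : ZMod N) 0 ξ * TT τ γ.1 γ.2 (ζ + ξ / N) := by
  rw [← FF_zero τ γ ξ, ← FF_eq hτ, FF, Finset.sum_mul]
  congr 1
  refine Finset.sum_congr rfl fun α _ => ?_
  rw [DD_eq_rr hne α ξ]; ring

lemma dual_pos (hτ : 0 < τ.im) (hne : ∀ α : ZMod N × ZMod N, TT τ α.1 α.2 (ζ / N) ≠ 0)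
    (γ : ZMod N × ZMod N) :
    (∑ α : ZMod N × ZMod N, ee (α.1 * γ.2 - α.2 * γ.1) * rr τ ζ α ζ) =
      kap N τ ζ * rr τ ζ γ ζ := by
  have h := dual_gen hτ hne γ ζ
  have h1 := DD_ne hne
  have h2 := hne γ
  rw [kap, rr]
  generalize TT τ γ.1 γ.2 (ζ + ζ / N) = X at *
  generalize TT τ γ.1 γ.2 (ζ / N) = Y at *
  field_simp
  linear_combination h

lemma dual_neg (hτ : 0 < τ.im) (hne : ∀ α : ZMod N × ZMod N, TT τ α.1 α.2 (ζ / N) ≠ 0)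
    (γ : ZMod N × ZMod N) :
    (∑ α : ZMod N × ZMod N, ee (α.1 * γ.2 - α.2 * γ.1) * rr τ ζ α (-ζ)) =
      - kap N τ ζ * rr τ ζ (-γ) (-ζ) := by
  have h := dual_gen hτ hne γ (-ζ)
  have h1 := DD_ne hne
  have h2 := hne (-γ)
  obtain ⟨c, hc, hcT⟩ := TT_neg τ γ.1 γ.2
  rw [TT_zero_neg, show ζ + -ζ / N = -(-ζ + ζ / N) by ring, hcT, neg_div, hcT] at h
  rw [kap, rr]
  simp only [Prod.fst_neg, Prod.snd_neg] at h2 ⊢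
  generalize TT τ (-γ.1) (-γ.2) (-ζ + ζ / N) = X at *
  generalize TT τ (-γ.1) (-γ.2) (ζ / N) = Y at *
  field_simp
  apply mul_left_cancel₀ hc
  linear_combination h

lemma kap_pow (hτ : 0 < τ.im) (hne : ∀ α : ZMod N × ZMod N, TT τ α.1 α.2 (ζ / N) ≠ 0) :
    ∃ m : ℕ, kap N τ ζ = (N : ℂ) ^ m := by
  have hN := NC (N := N)
  have hD := DD_ne hne
  set T : ℂ → ℂ := TT τ (0 : ZMod N) 0 with hT
  have hTd : Differentiable ℂ T := TT_diff hτ 0 0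
  have han : AnalyticAt ℂ T 0 := hTd.analyticAt 0
  have hnz : ¬ ∀ᶠ z in nhds (0:ℂ), T z = 0 := by
    intro h
    have ha : AnalyticOnNhd ℂ T Set.univ := fun x _ => hTd.analyticAt x
    have := ha.eqOn_zero_of_preconnected_of_eventuallyEq_zero isPreconnected_univ
      (Set.mem_univ 0) h
    exact T0_ne hτ hne (this (Set.mem_univ ζ))
  obtain ⟨m, g, hg, hg0, hTg⟩ := (han.exists_eventuallyEq_pow_smul_nonzero_iff).mpr hnz
  simp only [sub_zero, smul_eq_mul] at hTg
  refine ⟨m, ?_⟩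
  let G : ℂ → ℂ := fun x => ∏ β ∈ (Finset.univ : Finset (ZMod N × ZMod N)).erase 0, TT τ β.1 β.2 x
  have hGc : Continuous G := by
    apply continuous_finsetProd
    intro β _
    exact (TT_diff hτ β.1 β.2).continuous
  have hG : ∀ x, T x * G x * T ζ = DD τ (0 : ZMod N × ZMod N) 0 ζ * T (N * x) := by
    intro x
    rw [← Pi_eq hτ (N * x) ζ]
    congr 1
    unfold DD
    rw [← Finset.prod_erase_mul _ _ (Finset.mem_univ 0), mul_comm]
    simp only [ite_self, zero_add]
    congr 1
    · refine Finset.prod_congr rfl fun β _ => ?_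
      congr 1; field_simp
    · rw [mul_div_cancel_left₀ _ hN]; rfl
  have ht : Filter.Tendsto (fun x : ℂ => (N : ℂ) * x) (nhds 0) (nhds 0) := by
    have : Continuous (fun x : ℂ => (N : ℂ) * x) := by fun_prop
    simpa using this.tendsto 0
  have hev : ∀ᶠ x in nhdsWithin (0:ℂ) {0}ᶜ, g x * G x * T ζ =
      DD τ (0 : ZMod N × ZMod N) 0 ζ * ((N : ℂ) ^ m * g (N * x)) := by
    filter_upwards [self_mem_nhdsWithin, nhdsWithin_le_nhds hTg,
      nhdsWithin_le_nhds (ht.eventually hTg)] with x hx h1 h2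
    have h3 := hG x
    rw [h1, h2] at h3
    have hx' : x ^ m ≠ 0 := pow_ne_zero _ hx
    apply mul_left_cancel₀ hx'
    rw [mul_pow] at h3
    linear_combination h3
  have hgc := hg.continuousAt
  have l1 : Filter.Tendsto (fun x => g x * G x * T ζ) (nhdsWithin (0:ℂ) {0}ᶜ)
      (nhds (g 0 * G 0 * T ζ)) :=
    ((hgc.tendsto.mul (hGc.tendsto 0)).mul_const _).mono_left nhdsWithin_le_nhds
  have l2 : Filter.Tendsto (fun x => DD τ (0 : ZMod N × ZMod N) 0 ζ * ((N : ℂ) ^ m * g (N * x)))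
      (nhdsWithin (0:ℂ) {0}ᶜ) (nhds (DD τ (0 : ZMod N × ZMod N) 0 ζ * ((N : ℂ) ^ m * g 0))) :=
    (((hgc.tendsto.comp ht).const_mul _).const_mul _).mono_left nhdsWithin_le_nhds
  have := tendsto_nhds_unique (l1.congr' hev) l2
  have hG0 : G 0 = KK N τ := rfl
  rw [hG0] at this
  rw [kap]
  field_simp
  apply mul_left_cancel₀ hg0
  linear_combination this

lemma sum_ee (c : ZMod N) : (∑ x : ZMod N, ee (x * c)) = if c = 0 then (N : ℂ) else 0 := by
  have := AddChar.sum_mulShift c (ZMod.isPrimitive_stdAddChar N)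
  rw [ZMod.card] at this
  rw [this]; split_ifs <;> simp

lemma double_fourier (x : ZMod N × ZMod N → ℂ) (δ : ZMod N × ZMod N) :
    (∑ γ : ZMod N × ZMod N, ee (γ.1 * δ.2 - γ.2 * δ.1) *
      ∑ α : ZMod N × ZMod N, ee (α.1 * γ.2 - α.2 * γ.1) * x α) = (N : ℂ) ^ 2 * x δ := by
  simp only [Finset.mul_sum]
  rw [Finset.sum_comm]
  have h : ∀ α : ZMod N × ZMod N, (∑ γ : ZMod N × ZMod N, ee (γ.1 * δ.2 - γ.2 * δ.1) *
      (ee (α.1 * γ.2 - α.2 * γ.1) * x α)) = if α = δ then (N : ℂ) ^ 2 * x δ else 0 := by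
    intro α
    have h1 : ∀ γ : ZMod N × ZMod N, ee (γ.1 * δ.2 - γ.2 * δ.1) *
      (ee (α.1 * γ.2 - α.2 * γ.1) * x α) =
        (ee (γ.1 * (δ.2 - α.2)) * ee (γ.2 * (α.1 - δ.1))) * x α := by
      intro γ
      rw [← mul_assoc, ← ee_add, ← ee_add]; congr 2; ring
    simp only [h1]
    rw [← Finset.sum_mul, Fintype.sum_prod_type]
    simp only [← Finset.mul_sum]
    rw [← Finset.sum_mul, sum_ee, sum_ee]
    by_cases ha : α = δ
    · subst ha; simp [pow_two]
    · rw [if_neg ha]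
      by_cases h2 : δ.2 - α.2 = 0
      · rw [if_neg (fun h3 => ha (Prod.ext (sub_eq_zero.mp h3) (sub_eq_zero.mp h2).symm))]
        simp
      · rw [if_neg h2]; simp
  simp only [h]
  simp

lemma kap_eq (hτ : 0 < τ.im) (hne : ∀ α : ZMod N × ZMod N, TT τ α.1 α.2 (ζ / N) ≠ 0)
    (hs : kap N τ ζ ^ 2 = (N : ℂ) ^ 2) : kap N τ ζ = N := by
  obtain ⟨m, hm⟩ := kap_pow hτ hne
  rcases sq_eq_sq_iff_eq_or_eq_neg.mp hs with h | h
  · exact h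
  · exfalso
    rw [hm] at h
    have h2 : ((N ^ m + N : ℕ) : ℂ) = 0 := by push_cast; rw [h]; ring
    have h3 : N ^ m + N = 0 := by exact_mod_cast h2
    have := NeZero.ne N
    omega

lemma dual_pos' (hτ : 0 < τ.im) (hne : ∀ α : ZMod N × ZMod N, TT τ α.1 α.2 (ζ / N) ≠ 0)
    (γ : ZMod N × ZMod N) :
    (∑ α : ZMod N × ZMod N, ee (α.1 * γ.2 - α.2 * γ.1) * rr τ ζ α ζ) = N * rr τ ζ γ ζ := by
  by_cases h0 : ∀ δ : ZMod N × ZMod N, rr τ ζ δ ζ = 0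
  · simp [h0]
  · push Not at h0
    obtain ⟨δ, hδ⟩ := h0
    rw [dual_pos hτ hne, kap_eq hτ hne]
    have h := double_fourier (fun α => rr τ ζ α ζ) δ
    simp only [dual_pos hτ hne] at h
    apply mul_right_cancel₀ hδ
    rw [← h, pow_two, mul_assoc, ← dual_pos hτ hne, Finset.mul_sum]
    refine Finset.sum_congr rfl fun α _ => by ring

lemma dual_neg' (hτ : 0 < τ.im) (hne : ∀ α : ZMod N × ZMod N, TT τ α.1 α.2 (ζ / N) ≠ 0)
    (γ : ZMod N × ZMod N) :
    (∑ α : ZMod N × ZMod N, ee (α.1 * γ.2 - α.2 * γ.1) * rr τ ζ α (-ζ)) =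
      - N * rr τ ζ (-γ) (-ζ) := by
  by_cases h0 : ∀ δ : ZMod N × ZMod N, rr τ ζ δ (-ζ) = 0
  · simp [h0]
  · push Not at h0
    obtain ⟨δ, hδ⟩ := h0
    rw [dual_neg hτ hne, kap_eq hτ hne]
    have h := double_fourier (fun α => rr τ ζ α (-ζ)) δ
    simp only [dual_neg hτ hne] at h
    apply mul_right_cancel₀ hδ
    rw [← h]
    have h2 := dual_neg hτ hne (-δ)
    rw [neg_neg] at h2
    rw [pow_two, mul_assoc]
    have h3 : kap N τ ζ * rr τ ζ δ (-ζ) = - ∑ α : ZMod N × ZMod N,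
      ee (α.1 * (-δ).2 - α.2 * (-δ).1) * rr τ ζ α (-ζ) := by rw [h2]; ring
    rw [h3, ← Finset.sum_neg_distrib, Finset.mul_sum]
    rw [← Equiv.sum_comp (Equiv.neg (ZMod N × ZMod N))]
    refine Finset.sum_congr rfl fun α _ => ?_
    simp only [Equiv.neg_apply, Prod.fst_neg, Prod.snd_neg]
    rw [show (-α.1 * -δ.2 - -α.2 * -δ.1) = α.1 * δ.2 - α.2 * δ.1 by ring]
    ring
end dual

end helpers3

section helpers4

variable {N : ℕ} [NeZero N]

/-- partial Fourier transform of the coefficients -/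
def ww (τ ζ : ℂ) (m n : ZMod N) (ξ : ℂ) : ℂ :=
  ∑ k : ZMod N, ee (-(k * n)) * (rr τ ζ (m, k) ξ / N)

lemma rr_diff {τ : ℂ} (ζ : ℂ) (hτ : 0 < τ.im) (α : ZMod N × ZMod N) :
    Differentiable ℂ (rr τ ζ α) := by
  unfold rr
  apply Differentiable.div_const
  exact (TT_diff hτ α.1 α.2).comp (f := fun u : ℂ => u + ζ / N) (by fun_prop)

lemma ww_diff {τ : ℂ} (ζ : ℂ) (hτ : 0 < τ.im) (m n : ZMod N) :
    Differentiable ℂ (ww τ ζ m n) := by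
  unfold ww
  apply Differentiable.fun_sum
  intro k _
  exact ((rr_diff ζ hτ (m, k)).div_const _).const_mul _

lemma ww_add_one (τ ζ : ℂ) (m n : ZMod N) (ξ : ℂ) :
    ww τ ζ m n (ξ + 1) = - ee m * ww τ ζ m n ξ := by
  unfold ww rr
  rw [Finset.mul_sum]
  refine Finset.sum_congr rfl fun k _ => ?_
  rw [show ξ + 1 + ζ / N = (ξ + ζ / N) + 1 by ring, TT_add_one]
  ring

lemma ww_add_tau (τ ζ : ℂ) (m n : ZMod N) (ξ : ℂ) :
    ww τ ζ m n (ξ + τ) = - cexp (-(Real.pi * I * τ) - 2 * Real.pi * I * (ξ + ζ / N)) *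
      ww τ ζ m (n + 1) ξ := by
  unfold ww rr
  rw [Finset.mul_sum]
  refine Finset.sum_congr rfl fun k _ => ?_
  rw [show ξ + τ + ζ / N = (ξ + ζ / N) + τ by ring, TT_add_tau,
    show -(k * (n + 1)) = -(k * n) + -k by ring, ee_add]
  ring

lemma ww_zero {τ ζ : ℂ} (hne : ∀ α : ZMod N × ZMod N, TT τ α.1 α.2 (ζ / N) ≠ 0)
    (m n : ZMod N) : ww τ ζ m n 0 = if n = 0 then 1 else 0 := by
  have hN := NC (N := N)
  unfold ww rr
  have h : ∀ k : ZMod N, ee (-(k * n)) *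
      (TT τ (m, k).1 (m, k).2 (0 + ζ / N) / TT τ (m, k).1 (m, k).2 (ζ / N) / N) =
      ee (k * (-n)) * (1 / N) := by
    intro k
    rw [zero_add, div_self (hne (m, k))]; simp
  simp only [h]
  rw [← Finset.sum_mul, sum_ee]
  simp only [neg_eq_zero]
  split_ifs
  · field_simp
  · simp

lemma ww_symm {τ ζ : ℂ} (hτ : 0 < τ.im)
    (hne : ∀ α : ZMod N × ZMod N, TT τ α.1 α.2 (ζ / N) ≠ 0)
    (m n : ZMod N) : ww τ ζ m n ζ = ww τ ζ n m ζ := by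
  have hN := NC (N := N)
  have h0 : ∀ k : ZMod N, rr τ ζ (m, k) ζ = (1 / N : ℂ) *
      ∑ α : ZMod N × ZMod N, ee (α.1 * k - α.2 * m) * rr τ ζ α ζ := by
    intro k
    rw [dual_pos' hτ hne (m, k)]; field_simp
  calc ww τ ζ m n ζ = ∑ k : ZMod N, ∑ α : ZMod N × ZMod N,
        ee (k * (α.1 - n)) * (ee (-(α.2 * m)) * rr τ ζ α ζ * (1 / N ^ 2)) := by
        unfold ww
        refine Finset.sum_congr rfl fun k _ => ?_
        rw [h0, Finset.mul_sum, Finset.sum_div, Finset.mul_sum]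
        refine Finset.sum_congr rfl fun α _ => ?_
        rw [show α.1 * k - α.2 * m = k * α.1 + -(α.2 * m) by ring,
          show k * (α.1 - n) = k * α.1 + -(k * n) by ring, ee_add, ee_add]
        field_simp
    _ = ∑ α : ZMod N × ZMod N, (if α.1 - n = 0 then (N : ℂ) else 0) *
        (ee (-(α.2 * m)) * rr τ ζ α ζ * (1 / N ^ 2)) := by
        rw [Finset.sum_comm]
        refine Finset.sum_congr rfl fun α _ => ?_
        rw [← Finset.sum_mul, sum_ee]
    _ = ww τ ζ n m ζ := by
        rw [Fintype.sum_prod_type, Finset.sum_eq_single n]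
        · unfold ww
          refine Finset.sum_congr rfl fun k _ => ?_
          simp only [sub_self, if_true]
          field_simp
        · intro b _ hb
          simp [sub_eq_zero, hb]
        · simp

lemma ww_anti {τ ζ : ℂ} (hτ : 0 < τ.im)
    (hne : ∀ α : ZMod N × ZMod N, TT τ α.1 α.2 (ζ / N) ≠ 0)
    (m n : ZMod N) : ww τ ζ m n (-ζ) = - ww τ ζ (-n) (-m) (-ζ) := by
  have hN := NC (N := N)
  have h0 : ∀ k : ZMod N, rr τ ζ (m, k) (-ζ) = - (1 / N : ℂ) *
      ∑ α : ZMod N × ZMod N, ee (α.1 * (-k) - α.2 * (-m)) * rr τ ζ α (-ζ) := by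
    intro k
    rw [dual_neg' hτ hne (-m, -k)]
    simp only [Prod.neg_mk, neg_neg]
    field_simp
  calc ww τ ζ m n (-ζ) = ∑ k : ZMod N, ∑ α : ZMod N × ZMod N,
        ee (k * (-α.1 - n)) * (ee (α.2 * m) * rr τ ζ α (-ζ) * (- (1 / N ^ 2))) := by
        unfold ww
        refine Finset.sum_congr rfl fun k _ => ?_
        rw [h0, Finset.mul_sum, Finset.sum_div, Finset.mul_sum]
        refine Finset.sum_congr rfl fun α _ => ?_
        rw [show α.1 * (-k) - α.2 * (-m) = -(k * α.1) + (α.2 * m) by ring,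
          show k * (-α.1 - n) = -(k * α.1) + -(k * n) by ring, ee_add, ee_add]
        field_simp
    _ = ∑ α : ZMod N × ZMod N, (if -α.1 - n = 0 then (N : ℂ) else 0) *
        (ee (α.2 * m) * rr τ ζ α (-ζ) * (-(1 / N ^ 2))) := by
        rw [Finset.sum_comm]
        refine Finset.sum_congr rfl fun α _ => ?_
        rw [← Finset.sum_mul, sum_ee]
    _ = - ww τ ζ (-n) (-m) (-ζ) := by
        rw [Fintype.sum_prod_type, Finset.sum_eq_single (-n)]
        · unfold ww
          rw [← Finset.sum_neg_distrib]
          refine Finset.sum_congr rfl fun k _ => ?_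
          simp only [neg_neg, sub_self, if_true, mul_neg]
          field_simp
        · intro b _ hb
          have : ¬ (-b - n = 0) := by
            intro h; apply hb; linear_combination -h
          simp [this]
        · simp

/-- the four-term expression -/
def QQ (τ ζ : ℂ) (a0 a1 a2 b0 b1 b2 : ZMod N) (ξ : ℂ) : ℂ :=
  ww τ ζ (b2 - a2) (a0 - b2) (ξ + ζ) * ww τ ζ (b1 - a1) (b0 - a1) ξ +
  ww τ ζ (b2 - a1) (a0 - b2) (ξ + ζ) * ww τ ζ (b1 - a2) (b0 - a2) ξ -
  ww τ ζ (b1 - a2) (a0 - b1) (ξ + ζ) * ww τ ζ (b2 - a1) (b0 - a1) ξ -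
  ww τ ζ (b1 - a1) (a0 - b1) (ξ + ζ) * ww τ ζ (b2 - a2) (b0 - a2) ξ

lemma QQ_zero {τ ζ : ℂ} (hτ : 0 < τ.im)
    (hne : ∀ α : ZMod N × ZMod N, TT τ α.1 α.2 (ζ / N) ≠ 0)
    (a0 a1 a2 b0 b1 b2 : ZMod N) (h : a0 + a1 + a2 = b0 + b1 + b2) :
    QQ τ ζ a0 a1 a2 b0 b1 b2 0 = 0 := by
  unfold QQ
  simp only [ww_zero hne, zero_add]
  have h1 : (ww τ ζ (b2 - a2) (a0 - b2) ζ - ww τ ζ (b1 - a2) (a0 - b1) ζ) *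
      (if b0 - a1 = 0 then (1:ℂ) else 0) = 0 := by
    split_ifs with hb
    · rw [ww_symm hτ hne (b2 - a2), show a0 - b2 = b1 - a2 by linear_combination h + hb,
        show b2 - a2 = a0 - b1 by linear_combination -h - hb]
      ring
    · simp
  have h2 : (ww τ ζ (b2 - a1) (a0 - b2) ζ - ww τ ζ (b1 - a1) (a0 - b1) ζ) *
      (if b0 - a2 = 0 then (1:ℂ) else 0) = 0 := by
    split_ifs with hb
    · rw [ww_symm hτ hne (b2 - a1), show a0 - b2 = b1 - a1 by linear_combination h + hb,
        show b2 - a1 = a0 - b1 by linear_combination -h - hb]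
      ring
    · simp
  linear_combination h1 + h2

lemma QQ_neg {τ ζ : ℂ} (hτ : 0 < τ.im)
    (hne : ∀ α : ZMod N × ZMod N, TT τ α.1 α.2 (ζ / N) ≠ 0)
    (a0 a1 a2 b0 b1 b2 : ZMod N) (h : a0 + a1 + a2 = b0 + b1 + b2) :
    QQ τ ζ a0 a1 a2 b0 b1 b2 (-ζ) = 0 := by
  unfold QQ
  simp only [neg_add_cancel, ww_zero hne]
  have h1 : (if a0 - b2 = 0 then (1:ℂ) else 0) *
      (ww τ ζ (b1 - a1) (b0 - a1) (-ζ) + ww τ ζ (b1 - a2) (b0 - a2) (-ζ)) = 0 := by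
    split_ifs with hb
    · rw [ww_anti hτ hne (b1 - a1), show -(b0 - a1) = b1 - a2 by linear_combination h - hb,
        show -(b1 - a1) = b0 - a2 by linear_combination h - hb]
      ring
    · simp
  have h2 : (if a0 - b1 = 0 then (1:ℂ) else 0) *
      (ww τ ζ (b2 - a1) (b0 - a1) (-ζ) + ww τ ζ (b2 - a2) (b0 - a2) (-ζ)) = 0 := by
    split_ifs with hb
    · rw [ww_anti hτ hne (b2 - a1), show -(b0 - a1) = b2 - a2 by linear_combination h - hb,
        show -(b2 - a1) = b0 - a2 by linear_combination h - hb]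
      ring
    · simp
  linear_combination h1 - h2

lemma QQ_add_one (τ ζ : ℂ) (a0 a1 a2 b0 b1 b2 : ZMod N) (ξ : ℂ) :
    QQ τ ζ a0 a1 a2 b0 b1 b2 (ξ + 1) =
      ee (b1 - a1 + b2 - a2) * QQ τ ζ a0 a1 a2 b0 b1 b2 ξ := by
  unfold QQ
  rw [show ξ + 1 + ζ = (ξ + ζ) + 1 by ring]
  simp only [ww_add_one]
  have e1 : ee (b2 - a2) * ee (b1 - a1) = ee (b1 - a1 + b2 - a2) := by
    rw [← ee_add]; congr 1; ring
  have e2 : ee (b2 - a1) * ee (b1 - a2) = ee (b1 - a1 + b2 - a2) := by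
    rw [← ee_add]; congr 1; ring
  rw [mul_sub, mul_sub, mul_add]
  nth_rw 1 [← e1]
  rw [← e2]
  nth_rw 3 [e2]
  rw [← e1]
  ring

lemma QQ_add_tau (τ ζ : ℂ) (a0 a1 a2 b0 b1 b2 : ZMod N) (ξ : ℂ) :
    QQ τ ζ a0 a1 a2 b0 b1 b2 (ξ + τ) =
      (cexp (-(2 * Real.pi * I * τ)) * cexp (-(2 * Real.pi * I * (ζ + 2 * ζ / N)))) *
        cexp (-(2 * Real.pi * I * 2 * ξ)) *
        QQ τ ζ (a0 + 1) a1 a2 (b0 + 1) b1 b2 ξ := by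
  unfold QQ
  rw [show ξ + τ + ζ = (ξ + ζ) + τ by ring]
  simp only [ww_add_tau]
  rw [show (cexp (-(2 * Real.pi * I * τ)) * cexp (-(2 * Real.pi * I * (ζ + 2 * ζ / N)))) *
        cexp (-(2 * Real.pi * I * 2 * ξ)) =
      cexp (-(Real.pi * I * τ) - 2 * Real.pi * I * (ξ + ζ + ζ / N)) *
      cexp (-(Real.pi * I * τ) - 2 * Real.pi * I * (ξ + ζ / N)) by
    rw [← Complex.exp_add, ← Complex.exp_add, ← Complex.exp_add]; congr 1; ring]
  rw [show a0 - b2 + 1 = a0 + 1 - b2 by ring, show a0 - b1 + 1 = a0 + 1 - b1 by ring,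
    show b0 - a1 + 1 = b0 + 1 - a1 by ring, show b0 - a2 + 1 = b0 + 1 - a2 by ring]
  ring

lemma QQ_diff {τ : ℂ} (ζ : ℂ) (hτ : 0 < τ.im) (a0 a1 a2 b0 b1 b2 : ZMod N) :
    Differentiable ℂ (QQ τ ζ a0 a1 a2 b0 b1 b2) := by
  have h1 : ∀ m n : ZMod N, Differentiable ℂ (ww τ ζ m n) := ww_diff ζ hτ
  have h2 : ∀ m n : ZMod N, Differentiable ℂ (fun ξ => ww τ ζ m n (ξ + ζ)) := fun m n =>
    (h1 m n).comp (f := fun u : ℂ => u + ζ) (by fun_prop)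
  unfold QQ
  exact ((((h2 _ _).mul (h1 _ _)).add ((h2 _ _).mul (h1 _ _))).sub
    ((h2 _ _).mul (h1 _ _))).sub ((h2 _ _).mul (h1 _ _))

lemma QQ_eq_zero_gen {τ ζ : ℂ} (hτ : 0 < τ.im)
    (hne : ∀ α : ZMod N × ZMod N, TT τ α.1 α.2 (ζ / N) ≠ 0)
    (hne2 : ∀ α : ZMod N × ZMod N, TT τ α.1 α.2 (2 * ζ / N) ≠ 0)
    (a0 a1 a2 b0 b1 b2 : ZMod N) (h : a0 + a1 + a2 = b0 + b1 + b2) (ξ : ℂ) :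
    QQ τ ζ a0 a1 a2 b0 b1 b2 ξ = 0 := by
  have hN := NC (N := N)
  set δ := b1 - a1 + b2 - a2 with hδ
  let f : ZMod N → ℂ → ℂ := fun s u =>
    ∑ t : ZMod N, ee (t * s) * QQ τ ζ (a0 + t) a1 a2 (b0 + t) b1 b2 u
  have hcons : ∀ t : ZMod N, (a0 + t) + a1 + a2 = (b0 + t) + b1 + b2 := by
    intro t; linear_combination h
  have hf : ∀ s u, f s u = 0 := by
    intro s u
    obtain ⟨lam, hlam⟩ := exists_exp_eq (ee δ) (ee_ne _)
    have hT0 : TT τ (0 : ZMod N) 0 ζ ≠ 0 := T0_ne hτ hne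
    refine qp_two τ lam ((cexp (-(2 * Real.pi * I * τ)) *
        cexp (-(2 * Real.pi * I * (ζ + 2 * ζ / N)))) * ee (-s))
      (mul_ne_zero (mul_ne_zero (Complex.exp_ne_zero _) (Complex.exp_ne_zero _)) (ee_ne _))
      (f s) (fun u => TT τ (0 : ZMod N) 0 u * TT τ δ s (u + (ζ + 2 * ζ / N)))
      (fun u => TT τ (0 : ZMod N) 0 (u + ζ) * TT τ δ s (u + 2 * ζ / N))
      ?_ ?_ ?_ ?_ ?_ ?_ ?_ ?_ ?_ 0 (-ζ) ?_ ?_ ?_ ?_ ?_ ?_ u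
    · apply Differentiable.fun_sum
      intro t _
      exact (QQ_diff ζ hτ _ _ _ _ _ _).const_mul _
    · exact (TT_diff hτ 0 0).mul ((TT_diff hτ δ s).comp
        (f := fun u : ℂ => u + (ζ + 2 * ζ / N)) (by fun_prop))
    · exact ((TT_diff hτ 0 0).comp (f := fun u : ℂ => u + ζ) (by fun_prop)).mul
        ((TT_diff hτ δ s).comp (f := fun u : ℂ => u + 2 * ζ / N) (by fun_prop))
    · intro v
      rw [hlam]
      simp only [f, QQ_add_one]
      rw [Finset.mul_sum]
      refine Finset.sum_congr rfl fun t _ => by ring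
    · intro v
      simp only [f, QQ_add_tau]
      conv_rhs => rw [← Equiv.sum_comp (Equiv.addRight (1 : ZMod N))]
      rw [Finset.mul_sum]
      refine Finset.sum_congr rfl fun t _ => ?_
      simp only [Equiv.coe_addRight]
      rw [show t * s = (t + 1) * s + -s by ring, ee_add, ← add_assoc, ← add_assoc]
      ring
    · intro v
      rw [hlam, show v + 1 + (ζ + 2 * ζ / N) = (v + (ζ + 2 * ζ / N)) + 1 by ring]
      simp only [TT_add_one, ee_zero]
      ring
    · intro v
      rw [show v + τ + (ζ + 2 * ζ / N) = (v + (ζ + 2 * ζ / N)) + τ by ring]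
      simp only [TT_add_tau, neg_zero, ee_zero]
      have e : (cexp (-(2 * Real.pi * I * τ)) * cexp (-(2 * Real.pi * I * (ζ + 2 * ζ / N)))) *
        cexp (-(2 * Real.pi * I * 2 * v)) = cexp (-(Real.pi * I * τ) - 2 * Real.pi * I * v) *
          cexp (-(Real.pi * I * τ) - 2 * Real.pi * I * (v + (ζ + 2 * ζ / N))) := by
        rw [← Complex.exp_add, ← Complex.exp_add, ← Complex.exp_add]; congr 1; ring
      linear_combination (-ee (-s) * (TT τ (0 : ZMod N) 0 v *
        TT τ δ s (v + (ζ + 2 * ζ / N)))) * e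
    · intro v
      rw [hlam, show v + 1 + ζ = (v + ζ) + 1 by ring,
        show v + 1 + 2 * ζ / N = (v + 2 * ζ / N) + 1 by ring]
      simp only [TT_add_one, ee_zero]
      ring
    · intro v
      rw [show v + τ + ζ = (v + ζ) + τ by ring,
        show v + τ + 2 * ζ / N = (v + 2 * ζ / N) + τ by ring]
      simp only [TT_add_tau, neg_zero, ee_zero]
      have e : (cexp (-(2 * Real.pi * I * τ)) * cexp (-(2 * Real.pi * I * (ζ + 2 * ζ / N)))) *
        cexp (-(2 * Real.pi * I * 2 * v)) = cexp (-(Real.pi * I * τ) - 2 * Real.pi * I * (v + ζ)) *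
          cexp (-(Real.pi * I * τ) - 2 * Real.pi * I * (v + 2 * ζ / N)) := by
        rw [← Complex.exp_add, ← Complex.exp_add, ← Complex.exp_add]; congr 1; ring
      linear_combination (-ee (-s) * (TT τ (0 : ZMod N) 0 (v + ζ) *
        TT τ δ s (v + 2 * ζ / N))) * e
    · simp only [f]
      exact Finset.sum_eq_zero fun t _ => by rw [QQ_zero hτ hne _ _ _ _ _ _ (hcons t), mul_zero]
    · simp only [f]
      exact Finset.sum_eq_zero fun t _ => by rw [QQ_neg hτ hne _ _ _ _ _ _ (hcons t), mul_zero]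
    · simp only [TT_zero_zero, zero_mul]
    · simp only [TT_zero_neg]
      rw [show -ζ + (ζ + 2 * ζ / N) = 2 * ζ / N by ring]
      exact mul_ne_zero (neg_ne_zero.mpr hT0) (hne2 (δ, s))
    · simp only [zero_add]
      exact mul_ne_zero hT0 (hne2 (δ, s))
    · simp only [neg_add_cancel, TT_zero_zero, zero_mul]
  have h2 : ∑ s : ZMod N, f s ξ = N * QQ τ ζ a0 a1 a2 b0 b1 b2 ξ := by
    simp only [f]
    rw [Finset.sum_comm, Finset.sum_eq_single 0]
    · simp [ee_zero]
    · intro t _ ht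
      rw [← Finset.sum_mul]
      have := sum_ee t
      rw [if_neg ht] at this
      simp only [mul_comm t]
      rw [this, zero_mul]
    · simp
  simp only [hf, Finset.sum_const_zero] at h2
  rcases mul_eq_zero.mp h2.symm with h3 | h3
  · exact absurd h3 hN
  · exact h3

lemma TT_cont {τ : ℂ} (hτ : 0 < τ.im) (m k : ZMod N) : Continuous (TT τ m k) :=
  (TT_diff hτ m k).continuous

lemma QQ_eq_zero {τ ζ : ℂ} (hτ : 0 < τ.im)
    (hne : ∀ α : ZMod N × ZMod N, TT τ α.1 α.2 (ζ / N) ≠ 0)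
    (a0 a1 a2 b0 b1 b2 : ZMod N) (h : a0 + a1 + a2 = b0 + b1 + b2) (ξ : ℂ) :
    QQ τ ζ a0 a1 a2 b0 b1 b2 ξ = 0 := by
  have hN := NC (N := N)
  have hev1 : ∀ᶠ x in nhds ζ, ∀ α : ZMod N × ZMod N, TT τ α.1 α.2 (x / N) ≠ 0 := by
    rw [Filter.eventually_all]
    intro α
    have : Continuous fun x : ℂ => TT τ α.1 α.2 (x / N) :=
      (TT_cont hτ α.1 α.2).comp (by fun_prop)
    exact this.continuousAt.eventually_ne (hne α)
  have hev2 : ∀ᶠ x in nhdsWithin ζ {ζ}ᶜ, ∀ α : ZMod N × ZMod N, TT τ α.1 α.2 (2 * x / N) ≠ 0 := by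
    rw [Filter.eventually_all]
    intro α
    have hd : Differentiable ℂ fun x : ℂ => TT τ α.1 α.2 (2 * x / N) :=
      (TT_diff hτ α.1 α.2).comp (f := fun x : ℂ => 2 * x / N) (by fun_prop)
    rcases (hd.analyticAt ζ).eventually_eq_zero_or_eventually_ne_zero with h1 | h1
    · exfalso
      have ha : AnalyticOnNhd ℂ (fun x : ℂ => TT τ α.1 α.2 (2 * x / N)) Set.univ :=
        fun x _ => hd.analyticAt x
      have := ha.eqOn_zero_of_preconnected_of_eventuallyEq_zero isPreconnected_univ
        (Set.mem_univ ζ) h1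
      have h2 := this (Set.mem_univ (ζ / 2))
      simp only [Pi.zero_apply] at h2
      rw [show 2 * (ζ / 2) / (N : ℂ) = ζ / N by ring] at h2
      exact hne α h2
    · exact h1
  have hev : ∀ᶠ x in nhdsWithin ζ {ζ}ᶜ, QQ τ x a0 a1 a2 b0 b1 b2 ξ = 0 := by
    filter_upwards [nhdsWithin_le_nhds hev1, hev2] with x h1 h2
    exact QQ_eq_zero_gen hτ h1 h2 _ _ _ _ _ _ h ξ
  have hw : ∀ (m n : ZMod N) (c : ℂ → ℂ), Continuous c →
      ContinuousAt (fun x => ww τ x m n (c x)) ζ := by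
    intro m n c hc
    unfold ww rr
    refine tendsto_finset_sum _ fun k _ => ?_
    refine Filter.Tendsto.const_mul _ (Filter.Tendsto.div_const (Filter.Tendsto.div ?_ ?_ ?_) _)
    · have : Continuous fun x : ℂ => TT τ m k (c x + x / N) :=
        (TT_cont hτ m k).comp (by fun_prop)
      exact this.continuousAt
    · have : Continuous fun x : ℂ => TT τ m k (x / N) :=
        (TT_cont hτ m k).comp (by fun_prop)
      exact this.continuousAt
    · exact hne (m, k)
  have hQ : ContinuousAt (fun x => QQ τ x a0 a1 a2 b0 b1 b2 ξ) ζ := by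
    unfold QQ
    have c1 : Continuous fun x : ℂ => ξ + x := by fun_prop
    have c2 : Continuous fun _ : ℂ => ξ := by fun_prop
    exact ((((hw _ _ _ c1).mul (hw _ _ _ c2)).add ((hw _ _ _ c1).mul (hw _ _ _ c2))).sub
      ((hw _ _ _ c1).mul (hw _ _ _ c2))).sub ((hw _ _ _ c1).mul (hw _ _ _ c2))
  have l1 := hQ.tendsto.mono_left (nhdsWithin_le_nhds (s := {ζ}ᶜ))
  have l2 : Filter.Tendsto (fun x => QQ τ x a0 a1 a2 b0 b1 b2 ξ) (nhdsWithin ζ {ζ}ᶜ) (nhds 0) :=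
    tendsto_const_nhds.congr' (hev.mono fun x hx => hx.symm)
  exact tendsto_nhds_unique l1 l2

end helpers4

section helpers5

variable {N : ℕ} [NeZero N]

/-- the bijection between `Fin N` and `ZMod N` -/
def zc : Fin N ≃ ZMod N where
  toFun a := ((a : ℕ) : ZMod N)
  invFun z := ⟨z.val, z.val_lt⟩
  left_inv a := by ext; simp [ZMod.val_natCast_of_lt a.isLt]
  right_inv z := by simp

lemma zc_apply (a : Fin N) : zc a = ((a : ℕ) : ZMod N) := rfl

lemma zc_val (a : Fin N) : (zc a).val = (a : ℕ) := ZMod.val_natCast_of_lt a.isLt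

/-- shift matrices -/
def Sh (m : ZMod N) : Matrix (Fin N) (Fin N) ℂ :=
  Matrix.of fun a b => if zc b = zc a + m then 1 else 0

lemma Sh_mul (m n : ZMod N) : Sh m * Sh n = Sh (m + n) := by
  ext a b
  rw [Matrix.mul_apply, Finset.sum_eq_single (zc.symm (zc a + m))]
  · simp [Sh, add_assoc]
  · intro c _ hc
    have : ¬ zc c = zc a + m := by
      intro h; apply hc; rw [← h]; simp
    simp [Sh, this]
  · simp

lemma Sh_zero : Sh (0 : ZMod N) = 1 := by
  ext a b
  simp [Sh, Matrix.one_apply, eq_comm]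

lemma hMat_eq : hMat N = Sh 1 := by
  ext a b
  simp only [hMat, Sh, Matrix.of_apply]
  congr 1
  rw [← zc_val b, zc_apply a, ← Nat.cast_succ, Nat.succ_eq_add_one, ← ZMod.val_natCast]
  rw [ZMod.val_injective N |>.eq_iff]

lemma hMat_pow (n : ℕ) : hMat N ^ n = Sh (n : ZMod N) := by
  induction n with
  | zero => simp [Sh_zero]
  | succ n ih => rw [pow_succ, ih, hMat_eq, Sh_mul]; push_cast; rfl

lemma gMat_eq : gMat N = Matrix.diagonal fun j : Fin N => ee (zc j + 1) := by
  unfold gMat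
  congr 1
  funext j
  have := ZMod.stdAddChar_coe (N := N) ((j : ℕ) + 1 : ℤ)
  rw [zc_apply]
  push_cast at this
  rw [ee, this, eπ]
  congr 1; ring

lemma ee_nat_mul (n : ℕ) (x : ZMod N) : ee ((n : ZMod N) * x) = ee x ^ n := by
  induction n with
  | zero => simp [ee_zero]
  | succ n ih => rw [pow_succ, ← ih, ← ee_add]; congr 1; push_cast; ring

lemma gMat_pow (n : ℕ) : gMat N ^ n = Matrix.diagonal fun j : Fin N => ee ((n : ZMod N) * (zc j + 1)) := by
  rw [gMat_eq, Matrix.diagonal_pow]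
  congr 1
  funext j
  simp [ee_nat_mul]

lemma Imat_eq (α : Fin N × Fin N) : Imat N α =
    Matrix.diagonal (fun j : Fin N => ee (zc α.2 * (zc j + 1))) * Sh (zc α.1) := by
  rw [Imat, gMat_pow, hMat_pow]; rfl

lemma Imat_inv (α : Fin N × Fin N) : (Imat N α)⁻¹ =
    Sh (-zc α.1) * Matrix.diagonal (fun j : Fin N => ee (-(zc α.2 * (zc j + 1)))) := by
  apply Matrix.inv_eq_right_inv
  rw [Imat_eq, Matrix.mul_assoc, ← Matrix.mul_assoc (Sh _) (Sh _), Sh_mul, add_neg_cancel, Sh_zero,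
    Matrix.one_mul, Matrix.diagonal_mul_diagonal]
  simp only [← ee_add, add_neg_cancel, ee_zero]
  simp

lemma Wcoef_eq (α : Fin N × Fin N) (ξ ζ τ : ℂ) :
    Wcoef N α ξ ζ τ = rr τ ζ (zc α.1, zc α.2) ξ / N := by
  simp only [Wcoef, rr, TT, zc_val]
  rw [div_div, mul_comm]

lemma S_entry (ξ ζ τ : ℂ) (a a' b b' : Fin N) :
    (∑ α : Fin N × Fin N, Wcoef N α ξ ζ τ • (Imat N α ⊗ₖ (Imat N α)⁻¹)) (a, a') (b, b') =
      if zc a + zc a' = zc b + zc b' then ww τ ζ (zc b - zc a) (zc b' - zc a) ξ else 0 := by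
  have h : ∀ α : Fin N × Fin N,
      (Wcoef N α ξ ζ τ • (Imat N α ⊗ₖ (Imat N α)⁻¹)) (a, a') (b, b') =
      (fun β : ZMod N × ZMod N => if zc b = zc a + β.1 ∧ zc b' = zc a' - β.1 then
        ee (-(β.2 * (zc b' - zc a))) * (rr τ ζ β ξ / N) else 0) ((zc.prodCongr zc) α) := by
    intro α
    rw [Matrix.smul_apply, Matrix.kroneckerMap_apply, Imat_inv, Imat_eq, Wcoef_eq,
      Matrix.diagonal_mul, Matrix.mul_diagonal]
    simp only [Sh, Matrix.of_apply, Equiv.prodCongr_apply, Prod.map, ← sub_eq_add_neg]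
    by_cases h1 : zc b = zc a + zc α.1
    · by_cases h2 : zc b' = zc a' - zc α.1
      · rw [if_pos h1, if_pos h2, if_pos ⟨h1, h2⟩,
          show -(zc α.2 * (zc b' - zc a)) = zc α.2 * (zc a + 1) + -(zc α.2 * (zc b' + 1)) by ring,
          ee_add, smul_eq_mul]
        ring
      · simp [h2]
    · simp [h1]
  rw [Matrix.sum_apply, Finset.sum_congr rfl (fun α _ => h α)]
  rw [Equiv.sum_comp (zc.prodCongr zc : Fin N × Fin N ≃ ZMod N × ZMod N) (fun β : ZMod N × ZMod N =>
    if zc b = zc a + β.1 ∧ zc b' = zc a' - β.1 then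
        ee (-(β.2 * (zc b' - zc a))) * (rr τ ζ β ξ / N) else 0), Fintype.sum_prod_type,
    Finset.sum_eq_single (zc b - zc a)]
  · have : (zc b = zc a + (zc b - zc a) ∧ zc b' = zc a' - (zc b - zc a)) ↔
        zc a + zc a' = zc b + zc b' := by
      constructor
      · rintro ⟨_, h⟩; linear_combination -h
      · intro h; exact ⟨by ring, by linear_combination -h⟩
    simp only [this]
    split_ifs
    · rfl
    · simp
  · intro x _ hx
    refine Finset.sum_eq_zero fun k _ => ?_
    rw [if_neg]
    rintro ⟨h, _⟩
    apply hx
    rw [h]; ring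
  · simp

/-- the diagonal entries of `gHalf` -/
def dd (N : ℕ) (j : Fin N) : ℂ := eπ ((((j : ℕ) : ℂ) + 1) / N)

lemma dd_ne (j : Fin N) : dd N j ≠ 0 := Complex.exp_ne_zero _

/-- the scalar prefactor -/
def sc (N : ℕ) (ξ ζ τ : ℂ) : ℂ :=
  (eπ (ξ * (2 / N - 2)) * (kappaNum N ξ ζ τ / kappaDen N ξ ζ τ) *
      jTheta (1/2) (1/2) ζ τ / jTheta (1/2) (1/2) (ξ + ζ) τ)

lemma Rmat_entry (ξ ζ τ : ℂ) (a a' b b' : Fin N) :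
    Rmat N ξ ζ τ (a, a') (b, b') = sc N ξ ζ τ * (dd N a * dd N a') * (dd N b * dd N b')⁻¹ *
      if zc a + zc a' = zc b + zc b' then ww τ ζ (zc b - zc a) (zc b' - zc a) ξ else 0 := by
  have h1 : gHalf N ⊗ₖ gHalf N = Matrix.diagonal fun p : Fin N × Fin N => dd N p.1 * dd N p.2 := by
    unfold gHalf
    rw [Matrix.diagonal_kronecker_diagonal]; rfl
  have h2 : (gHalf N ⊗ₖ gHalf N)⁻¹ =
      Matrix.diagonal fun p : Fin N × Fin N => (dd N p.1 * dd N p.2)⁻¹ := by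
    apply Matrix.inv_eq_right_inv
    rw [h1, Matrix.diagonal_mul_diagonal, ← Matrix.diagonal_one]
    congr 1
    funext p
    exact mul_inv_cancel₀ (mul_ne_zero (dd_ne _) (dd_ne _))
  rw [Rmat, h2, h1, Matrix.mul_diagonal, Matrix.diagonal_mul, Zmat, Matrix.smul_apply, S_entry,
    smul_eq_mul, sc]
  ring

lemma Y_entry (ξ ζ τ : ℂ) (a0 a1 a2 b0 b1 b2 : Fin N) :
    (∑ c : Fin N, Rmat N (ξ + ζ) ζ τ (a2, a0) (b2, c) * Rmat N ξ ζ τ (a1, c) (b1, b0)) =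
      (sc N (ξ + ζ) ζ τ * sc N ξ ζ τ * (dd N a0 * (dd N a1 * dd N a2)) *
        (dd N b0 * (dd N b1 * dd N b2))⁻¹) *
      if zc a0 + (zc a1 + zc a2) = zc b0 + (zc b1 + zc b2) then
        ww τ ζ (zc b2 - zc a2) (zc a0 - zc b2) (ξ + ζ) *
          ww τ ζ (zc b1 - zc a1) (zc b0 - zc a1) ξ else 0 := by
  rw [Finset.sum_eq_single (zc.symm (zc a2 + zc a0 - zc b2))]
  · set c := zc.symm (zc a2 + zc a0 - zc b2) with hc
    have hcz : zc c = zc a2 + zc a0 - zc b2 := by rw [hc]; simp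
    rw [Rmat_entry, Rmat_entry, hcz]
    rw [if_pos (by ring), show zc a2 + zc a0 - zc b2 - zc a2 = zc a0 - zc b2 by ring]
    have : (zc a1 + (zc a2 + zc a0 - zc b2) = zc b1 + zc b0) ↔
        (zc a0 + (zc a1 + zc a2) = zc b0 + (zc b1 + zc b2)) := by
      constructor <;> intro h <;> linear_combination h
    simp only [this]
    have d0 := dd_ne c
    have d1 := dd_ne b0
    have d2 := dd_ne b1
    have d3 := dd_ne b2
    split_ifs
    · field_simp
    · simp
  · intro c _ hc
    rw [Rmat_entry, if_neg, mul_zero, zero_mul]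
    intro h
    apply hc
    rw [h]; simp
  · simp

/-- pair products -/
def YY (N : ℕ) (ξ ζ τ : ℂ) (a0 a1 a2 b0 b1 b2 : Fin N) : ℂ :=
  ∑ c : Fin N, Rmat N (ξ + ζ) ζ τ (a2, a0) (b2, c) * Rmat N ξ ζ τ (a1, c) (b1, b0)

lemma YY_four {ζ τ : ℂ} (hτ : 0 < τ.im)
    (hne : ∀ α : ZMod N × ZMod N, TT τ α.1 α.2 (ζ / N) ≠ 0) (ξ : ℂ)
    (a0 a1 a2 b0 b1 b2 : Fin N) :
    YY N ξ ζ τ a0 a1 a2 b0 b1 b2 + YY N ξ ζ τ a0 a2 a1 b0 b1 b2 -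
      YY N ξ ζ τ a0 a1 a2 b0 b2 b1 - YY N ξ ζ τ a0 a2 a1 b0 b2 b1 = 0 := by
  simp only [YY, Y_entry]
  rw [add_comm (zc a2) (zc a1), add_comm (zc b2) (zc b1), mul_comm (dd N a2) (dd N a1),
    mul_comm (dd N b2) (dd N b1)]
  by_cases h : zc a0 + (zc a1 + zc a2) = zc b0 + (zc b1 + zc b2)
  · simp only [if_pos h]
    have := QQ_eq_zero hτ hne (zc a0) (zc a1) (zc a2) (zc b0) (zc b1) (zc b2)
      (by linear_combination h) ξ
    unfold QQ at this
    rw [← mul_add, ← mul_sub, ← mul_sub, this, mul_zero]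
  · simp only [if_neg h]; simp

lemma hne_of_gen {ξ ζ τ : ℂ} (h : Rgeneric N ξ ζ τ) (α : ZMod N × ZMod N) :
    TT τ α.1 α.2 (ζ / N) ≠ 0 := by
  have := h.2.1 (zc.symm α.1, zc.symm α.2)
  simp only [← zc_val, Equiv.apply_symm_apply] at this
  exact this

end helpers5

section helpers6

section perm
variable {N : ℕ} {ι : Type} [Fintype ι] [DecidableEq ι]

/-- permutation of tensor factors -/
def PM (N : ℕ) {ι : Type} [Fintype ι] [DecidableEq ι] (π : Equiv.Perm ι) :
    Matrix (ι → Fin N) (ι → Fin N) ℂ :=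
  Matrix.of fun a b => if a = b ∘ π.symm then 1 else 0

lemma PM_mul_apply (π : Equiv.Perm ι) (M : Matrix (ι → Fin N) (ι → Fin N) ℂ) (a b : ι → Fin N) :
    (PM N π * M) a b = M (a ∘ π) b := by
  rw [Matrix.mul_apply, Finset.sum_eq_single (a ∘ π)]
  · have : a = (a ∘ π) ∘ π.symm := by funext i; simp
    simp only [PM, Matrix.of_apply]
    rw [if_pos this, one_mul]
  · intro c _ hc
    simp only [PM, Matrix.of_apply]
    rw [if_neg, zero_mul]
    intro h; apply hc; rw [h]; funext i; simp
  · simp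

lemma mul_PM_apply (π : Equiv.Perm ι) (M : Matrix (ι → Fin N) (ι → Fin N) ℂ) (a b : ι → Fin N) :
    (M * PM N π) a b = M a (b ∘ π.symm) := by
  rw [Matrix.mul_apply, Finset.sum_eq_single (b ∘ π.symm)]
  · simp [PM]
  · intro c _ hc
    simp [PM, hc]
  · simp

lemma PM_mul (π ρ : Equiv.Perm ι) : PM N π * PM N ρ = PM N (π * ρ) := by
  ext a b
  rw [PM_mul_apply]
  simp only [PM, Matrix.of_apply]
  congr 1
  apply propext
  constructor
  · intro h
    funext i
    have := congrFun h (π.symm i)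
    simpa [Equiv.Perm.mul_def] using this
  · rintro rfl
    funext i
    simp [Equiv.Perm.mul_def]

lemma PM_one : PM N (1 : Equiv.Perm ι) = 1 := by
  ext a b
  simp [PM, Matrix.one_apply, Equiv.Perm.one_def]

lemma PM_act2 (π : Equiv.Perm ι) (i j : ι) (M : Matrix (Fin N × Fin N) (Fin N × Fin N) ℂ) :
    PM N π * act2 i j M = act2 (π i) (π j) M * PM N π := by
  ext a b
  rw [PM_mul_apply, mul_PM_apply]
  simp only [act2, Matrix.of_apply, Function.comp, Equiv.symm_apply_apply]
  congr 2
  apply propext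
  constructor
  · intro h l h1 h2
    have := h (π.symm l) (fun h3 => h1 (by rw [← h3]; simp)) (fun h3 => h2 (by rw [← h3]; simp))
    simpa using this
  · intro h l h1 h2
    have := h (π l) (fun h3 => h1 (π.injective h3)) (fun h3 => h2 (π.injective h3))
    simpa using this

lemma act2_pair {i j l : ι} (hij : i ≠ j) (hil : i ≠ l) (hjl : j ≠ l)
    (M M' : Matrix (Fin N × Fin N) (Fin N × Fin N) ℂ) (a b : ι → Fin N) :
    (act2 j l M * act2 i l M') a b =
      (if ∀ m, m ≠ i → m ≠ j → m ≠ l → a m = b m then 1 else 0) *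
        ∑ c : Fin N, M (a j, a l) (b j, c) * M' (a i, c) (b i, b l) := by
  rw [Matrix.mul_apply, Finset.mul_sum]
  symm
  refine Finset.sum_of_injOn (fun c => Function.update (Function.update a j (b j)) l c)
    ?_ ?_ ?_ ?_
  · intro c _ c' _ h
    have := congrFun h l
    simpa using this
  · intro c _; simp
  · intro c _ hc
    simp only [act2, Matrix.of_apply]
    by_cases h1 : ∀ m, m ≠ j → m ≠ l → a m = c m
    · by_cases h2 : ∀ m, m ≠ i → m ≠ l → c m = b m
      · exfalso
        apply hc
        refine ⟨c l, by simp, ?_⟩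
        funext m
        by_cases hm : m = l
        · subst hm; simp
        · by_cases hmj : m = j
          · subst hmj; simp [hm, h2 m hij.symm hm]
          · simp [hm, hmj, h1 m hmj hm]
      · rw [if_neg h2]; simp
    · rw [if_neg h1]; simp
  · intro c _
    simp only [act2, Matrix.of_apply]
    have hpos : ∀ m, m ≠ j → m ≠ l →
        a m = Function.update (Function.update a j (b j)) l c m := by
      intro m h1 h2; simp [h1, h2]
    rw [if_pos hpos]
    have : (∀ m, m ≠ i → m ≠ l → Function.update (Function.update a j (b j)) l c m = b m) ↔
        (∀ m, m ≠ i → m ≠ j → m ≠ l → a m = b m) := by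
      constructor
      · intro h m h1 h2 h3
        simpa [h2, h3] using h m h1 h3
      · intro h m h1 h3
        by_cases h2 : m = j
        · subst h2; simp [h3]
        · simp [h2, h3, h m h1 h2 h3]
    simp only [this]
    simp only [Function.update_self, Function.update_of_ne hjl, Function.update_of_ne hil,
      Function.update_of_ne hij]
    ring

lemma pair_zero [NeZero N] {ζ τ : ℂ} (hτ : 0 < τ.im)
    (hne : ∀ α : ZMod N × ZMod N, TT τ α.1 α.2 (ζ / N) ≠ 0) (ξ : ℂ)
    {i j l : ι} (hij : i ≠ j) (hil : i ≠ l) (hjl : j ≠ l) :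
    (1 + PM N (Equiv.swap i j)) * (act2 j l (Rmat N (ξ + ζ) ζ τ) * act2 i l (Rmat N ξ ζ τ)) *
      (1 - PM N (Equiv.swap i j)) = 0 := by
  set Q := act2 j l (Rmat N (ξ + ζ) ζ τ) * act2 i l (Rmat N ξ ζ τ) with hQ
  have h : Q + PM N (Equiv.swap i j) * Q - Q * PM N (Equiv.swap i j) -
      PM N (Equiv.swap i j) * Q * PM N (Equiv.swap i j) = 0 := by
    ext a b
    simp only [Matrix.sub_apply, Matrix.add_apply, Matrix.zero_apply, mul_PM_apply, PM_mul_apply,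
      Equiv.symm_swap]
    rw [hQ]
    simp only [act2_pair hij hil hjl]
    have hl : Equiv.swap i j l = l := Equiv.swap_apply_of_ne_of_ne hil.symm hjl.symm
    have hm : ∀ m, m ≠ i → m ≠ j → Equiv.swap i j m = m := fun m h1 h2 =>
      Equiv.swap_apply_of_ne_of_ne h1 h2
    have i1 : (∀ m, m ≠ i → m ≠ j → m ≠ l → (a ∘ Equiv.swap i j) m = b m) ↔
        (∀ m, m ≠ i → m ≠ j → m ≠ l → a m = b m) := by
      refine forall_congr' fun m => forall_congr' fun h1 => forall_congr' fun h2 => ?_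
      simp [hm m h1 h2]
    have i2 : (∀ m, m ≠ i → m ≠ j → m ≠ l → a m = (b ∘ Equiv.swap i j) m) ↔
        (∀ m, m ≠ i → m ≠ j → m ≠ l → a m = b m) := by
      refine forall_congr' fun m => forall_congr' fun h1 => forall_congr' fun h2 => ?_
      simp [hm m h1 h2]
    have i3 : (∀ m, m ≠ i → m ≠ j → m ≠ l →
        (a ∘ Equiv.swap i j) m = (b ∘ Equiv.swap i j) m) ↔
        (∀ m, m ≠ i → m ≠ j → m ≠ l → a m = b m) := by
      refine forall_congr' fun m => forall_congr' fun h1 => forall_congr' fun h2 => ?_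
      simp [hm m h1 h2]
    simp only [i1, i2, i3]
    simp only [Function.comp, Equiv.swap_apply_left, Equiv.swap_apply_right, hl]
    have := YY_four hτ hne ξ (a l) (a i) (a j) (b l) (b i) (b j)
    unfold YY at this
    rw [← mul_add, ← mul_sub, ← mul_sub, this, mul_zero]
  rw [← h]
  noncomm_ring
end perm

lemma abstract_step {n : Type} [Fintype n] [DecidableEq n] (P A X Q Y : Matrix n n ℂ)
    (hPA : P * A = -A) (hX : P * X = X * P) (hY : P * Y = Y * P)
    (hQ : (1 + P) * Q * (1 - P) = 0) : P * (X * Q * Y * A) = - (X * Q * Y * A) := by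
  have h1 : (1 + P) * (X * Q * Y * A) = X * ((1 + P) * Q) * (Y * A) := by
    have : (1 + P) * X = X * (1 + P) := by rw [add_mul, mul_add, hX]; simp
    calc _ = ((1 + P) * X) * (Q * (Y * A)) := by noncomm_ring
      _ = _ := by rw [this]; noncomm_ring
  have h2 : (2:ℂ) • (Y * A) = (1 - P) * (Y * A) := by
    rw [sub_mul, ← Matrix.mul_assoc P, hY, Matrix.mul_assoc, hPA, two_smul]
    simp
  have h3 : (2:ℂ) • ((1 + P) * (X * Q * Y * A)) = 0 := by
    rw [h1, ← Matrix.mul_smul, h2]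
    calc _ = X * ((1 + P) * Q * (1 - P)) * (Y * A) := by noncomm_ring
      _ = 0 := by rw [hQ]; simp
  have h4 : (1 + P) * (X * Q * Y * A) = 0 := by
    rcases smul_eq_zero.mp h3 with h | h
    · norm_num at h
    · exact h
  rw [add_mul, Matrix.one_mul] at h4
  exact eq_neg_of_add_eq_zero_right h4

lemma inv_preserves {n : Type} [Fintype n] [DecidableEq n] (A L M : Matrix n n ℂ)
    (hA : A * A = A) (hM : A * (M * A) = M * A) (hL : L * M = 1) : L * A = A * L * A := by
  have hinj : Function.Injective M.mulVecLin := by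
    intro x y h
    have := congrArg L.mulVec h
    simpa [Matrix.mulVec_mulVec, hL] using this
  set V := LinearMap.range A.mulVecLin with hV
  have hle : V.map M.mulVecLin ≤ V := by
    rintro _ ⟨_, ⟨w, rfl⟩, rfl⟩
    refine ⟨M.mulVec (A.mulVec w), ?_⟩
    simp [Matrix.mulVec_mulVec, hM]
  have heq : V.map M.mulVecLin = V :=
    Submodule.eq_of_le_of_finrank_eq hle (Submodule.equivMapOfInjective _ hinj V).finrank_eq.symm
  have key : ∀ v, (L * A).mulVec v = (A * L * A).mulVec v := by
    intro v
    have hv : A.mulVec v ∈ V := ⟨v, rfl⟩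
    rw [← heq] at hv
    obtain ⟨_, ⟨w, rfl⟩, hw⟩ := hv
    simp only [Matrix.mulVecLin_apply] at hw
    have h1 : (L * A).mulVec v = A.mulVec w := by
      rw [← Matrix.mulVec_mulVec, ← hw, Matrix.mulVec_mulVec, hL, Matrix.one_mulVec]
    rw [Matrix.mul_assoc, ← Matrix.mulVec_mulVec v A (L * A), h1, Matrix.mulVec_mulVec, hA]
  exact Matrix.ext_of_mulVec_single fun i => key _

section ext
variable {k : ℕ}

/-- extend a permutation, fixing the last index -/
def extP (σ : Equiv.Perm (Fin k)) : Equiv.Perm (Fin (k + 1)) where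
  toFun := Fin.lastCases (Fin.last k) (fun i => Fin.castSucc (σ i))
  invFun := Fin.lastCases (Fin.last k) (fun i => Fin.castSucc (σ.symm i))
  left_inv x := by
    refine Fin.lastCases ?_ (fun i => ?_) x <;> simp
  right_inv x := by
    refine Fin.lastCases ?_ (fun i => ?_) x <;> simp

lemma extP_cast (σ : Equiv.Perm (Fin k)) (i : Fin k) :
    extP σ (Fin.castSucc i) = Fin.castSucc (σ i) := by simp [extP]
lemma extP_last (σ : Equiv.Perm (Fin k)) : extP σ (Fin.last k) = Fin.last k := by simp [extP]
lemma extP_symm_cast (σ : Equiv.Perm (Fin k)) (i : Fin k) :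
    (extP σ).symm (Fin.castSucc i) = Fin.castSucc (σ.symm i) := by simp [extP]
lemma extP_symm_last (σ : Equiv.Perm (Fin k)) : (extP σ).symm (Fin.last k) = Fin.last k := by
  simp [extP]

lemma extP_mul (σ ρ : Equiv.Perm (Fin k)) : extP σ * extP ρ = extP (σ * ρ) := by
  ext x
  refine Fin.lastCases ?_ (fun i => ?_) x <;> simp [extP_cast, extP_last]

lemma extP_one : extP (1 : Equiv.Perm (Fin k)) = 1 := by
  ext x
  refine Fin.lastCases ?_ (fun i => ?_) x <;> simp [extP_cast, extP_last]

lemma extP_swap (i j : Fin k) :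
    extP (Equiv.swap i j) = Equiv.swap (Fin.castSucc i) (Fin.castSucc j) := by
  apply Equiv.ext
  intro x
  refine Fin.lastCases ?_ (fun l => ?_) x
  · rw [extP_last, Equiv.swap_apply_of_ne_of_ne (Fin.castSucc_lt_last i).ne'
      (Fin.castSucc_lt_last j).ne']
  · rw [extP_cast]
    simp only [Equiv.swap_apply_def, Fin.castSucc_inj]
    split_ifs <;> rfl

lemma asym_eq (N : ℕ) : asymExt N k = (k.factorial : ℂ)⁻¹ • ∑ σ : Equiv.Perm (Fin k),
    (((Equiv.Perm.sign σ : ℤ) : ℂ)) • PM N (extP σ) := by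
  unfold asymExt
  congr 1
  refine Finset.sum_congr rfl fun σ _ => ?_
  congr 1
  ext a b
  simp only [PM, Matrix.of_apply]
  congr 1
  apply propext
  constructor
  · rintro ⟨h1, h2⟩
    funext x
    refine Fin.lastCases ?_ (fun l => ?_) x
    · simp [extP_symm_last, h2]
    · simp [extP_symm_cast, h1]
  · intro h
    rw [h]
    simp [extP_symm_cast, extP_symm_last]

lemma sign_sq (σ : Equiv.Perm (Fin k)) :
    ((Equiv.Perm.sign σ : ℤ) : ℂ) * ((Equiv.Perm.sign σ : ℤ) : ℂ) = 1 := by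
  rcases Int.units_eq_one_or (Equiv.Perm.sign σ) with h | h <;> rw [h] <;> simp

lemma PM_asym (N : ℕ) (ρ : Equiv.Perm (Fin k)) :
    PM N (extP ρ) * asymExt N k = ((Equiv.Perm.sign ρ : ℤ) : ℂ) • asymExt N k := by
  rw [asym_eq, Matrix.mul_smul, smul_comm]
  congr 1
  rw [Matrix.mul_sum, Finset.smul_sum]
  conv_rhs => rw [← Equiv.sum_comp (Equiv.mulLeft ρ)]
  refine Finset.sum_congr rfl fun σ _ => ?_
  rw [Matrix.mul_smul, PM_mul, extP_mul, Equiv.coe_mulLeft, smul_smul]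
  congr 1
  rw [Equiv.Perm.sign_mul]
  push_cast
  rw [← mul_assoc, sign_sq, one_mul]

lemma asym_mul (N : ℕ) (B : Matrix (Fin (k+1) → Fin N) (Fin (k+1) → Fin N) ℂ)
    (h : ∀ σ : Equiv.Perm (Fin k), PM N (extP σ) * B = ((Equiv.Perm.sign σ : ℤ) : ℂ) • B) :
    asymExt N k * B = B := by
  rw [asym_eq, Matrix.smul_mul, Matrix.sum_mul]
  have : ∀ σ : Equiv.Perm (Fin k),
      (((Equiv.Perm.sign σ : ℤ) : ℂ) • PM N (extP σ)) * B = B := by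
    intro σ
    rw [Matrix.smul_mul, h, smul_smul, sign_sq, one_smul]
  simp only [this]
  rw [Finset.sum_const, Finset.card_univ, Fintype.card_perm, Fintype.card_fin,
    ← Nat.cast_smul_eq_nsmul ℂ, smul_smul, inv_mul_cancel₀, one_smul]
  exact_mod_cast Nat.factorial_ne_zero k

end ext

section prod
variable {n : Type} [Fintype n] [DecidableEq n]

/-- ordered products -/
def MM (f : ℕ → Matrix n n ℂ) : ℕ → Matrix n n ℂ
  | 0 => 1
  | (m + 1) => f m * MM f m

lemma MM_split (f : ℕ → Matrix n n ℂ) (P : Matrix n n ℂ) (i : ℕ)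
    (hc : ∀ j, j ≠ i → j ≠ i + 1 → P * f j = f j * P) (m : ℕ) :
    ∃ X, P * X = X * P ∧ MM f (i + 2 + m) = X * (f (i + 1) * f i) * MM f i := by
  induction m with
  | zero => exact ⟨1, by simp, by simp [MM, Matrix.mul_assoc]⟩
  | succ m ih =>
    obtain ⟨X, hX, h⟩ := ih
    refine ⟨f (i + 2 + m) * X, ?_, ?_⟩
    · rw [← Matrix.mul_assoc, hc _ (by omega) (by omega), Matrix.mul_assoc, hX, Matrix.mul_assoc]
    · rw [← add_assoc, MM, h]; simp only [Matrix.mul_assoc]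

lemma MM_comm (f : ℕ → Matrix n n ℂ) (P : Matrix n n ℂ) (i : ℕ)
    (hc : ∀ j, j < i → P * f j = f j * P) : P * MM f i = MM f i * P := by
  induction i with
  | zero => simp [MM]
  | succ m ih =>
    rw [MM, ← Matrix.mul_assoc, hc m (by omega), Matrix.mul_assoc, ih (fun j hj => hc j (by omega)),
      Matrix.mul_assoc]

lemma list_mul_MM (f : ℕ → Matrix n n ℂ) (m : ℕ) (hu : ∀ j, j < m → IsUnit (f j)) :
    (List.ofFn fun i : Fin m => (f i)⁻¹).prod * MM f m = 1 := by
  induction m with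
  | zero => simp [MM]
  | succ m ih =>
    rw [List.ofFn_succ', List.concat_eq_append, List.prod_append, MM, List.prod_singleton,
      Matrix.mul_assoc, ← Matrix.mul_assoc _ (f m)]
    have h1 : (f ((Fin.last m : Fin (m+1)) : ℕ))⁻¹ * f m = 1 := by
      rw [Fin.val_last]
      exact Matrix.nonsing_inv_mul _ ((Matrix.isUnit_iff_isUnit_det _).mp (hu m (by omega)))
    rw [h1, Matrix.one_mul]
    exact ih (fun j hj => hu j (by omega))
end prod

theorem fused_aux (N k : ℕ) (hN : 2 ≤ N) (hk2 : 2 ≤ k)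
    (ξ ζ τ : ℂ) (hτ : 0 < τ.im)
    (hgen : ∀ i : Fin k, Rgeneric N (ξ + i * ζ) ζ τ)
    (hinv : ∀ i : Fin k,
      IsUnit (act2 (Fin.castSucc i) (Fin.last k) (Rmat N (ξ + i * ζ) ζ τ))) :
    (List.ofFn fun i : Fin k =>
        (act2 (Fin.castSucc i) (Fin.last k) (Rmat N (ξ + i * ζ) ζ τ))⁻¹).prod * asymExt N k =
      asymExt N k * (List.ofFn fun i : Fin k =>
        (act2 (Fin.castSucc i) (Fin.last k) (Rmat N (ξ + i * ζ) ζ τ))⁻¹).prod * asymExt N k := by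
  have : NeZero N := ⟨by omega⟩
  have hne : ∀ α : ZMod N × ZMod N, TT τ α.1 α.2 (ζ / N) ≠ 0 :=
    hne_of_gen (hgen ⟨0, by omega⟩)
  let f : ℕ → Matrix (Fin (k+1) → Fin N) (Fin (k+1) → Fin N) ℂ := fun j =>
    if h : j < k then act2 (Fin.castSucc ⟨j, h⟩) (Fin.last k) (Rmat N (ξ + j * ζ) ζ τ) else 1
  have hf : ∀ i : Fin k, f i =
      act2 (Fin.castSucc i) (Fin.last k) (Rmat N (ξ + i * ζ) ζ τ) := by
    intro i
    simp only [f]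
    rw [dif_pos i.isLt]
  have hlist : (List.ofFn fun i : Fin k =>
        (act2 (Fin.castSucc i) (Fin.last k) (Rmat N (ξ + i * ζ) ζ τ))⁻¹) =
      List.ofFn fun i : Fin k => (f i)⁻¹ := by
    congr 1
    funext i
    rw [hf]
  rw [hlist]
  have hLM := list_mul_MM f k (fun j hj => by rw [hf ⟨j, hj⟩]; exact hinv ⟨j, hj⟩)
  have hadj : ∀ (i : ℕ) (hi : i + 1 < k),
      PM N (extP (Equiv.swap (⟨i, by omega⟩ : Fin k) ⟨i + 1, hi⟩)) * (MM f k * asymExt N k) =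
        - (MM f k * asymExt N k) := by
    intro i hi
    set x : Fin k := ⟨i, by omega⟩ with hx
    set y : Fin k := ⟨i + 1, hi⟩ with hy
    have hxy : x ≠ y := by
      intro h; have := congrArg Fin.val h; simp [hx, hy] at this
    have hc : ∀ j, j ≠ i → j ≠ i + 1 →
        PM N (extP (Equiv.swap x y)) * f j = f j * PM N (extP (Equiv.swap x y)) := by
      intro j h1 h2
      simp only [f]
      split_ifs with h
      · rw [PM_act2, extP_cast, extP_last, Equiv.swap_apply_of_ne_of_ne]
        · intro h3; apply h1; have := congrArg Fin.val h3; simpa [hx] using this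
        · intro h3; apply h2; have := congrArg Fin.val h3; simpa [hy] using this
      · simp
    obtain ⟨X, hX, hM⟩ := MM_split f _ i hc (k - (i + 2))
    rw [show i + 2 + (k - (i + 2)) = k by omega] at hM
    have hY := MM_comm f _ i (fun j hj => hc j (by omega) (by omega))
    rw [hM]
    apply abstract_step _ _ _ _ _ _ hX hY
    · have e1 : f (i + 1) = act2 (Fin.castSucc y) (Fin.last k)
          (Rmat N ((ξ + i * ζ) + ζ) ζ τ) := by
        rw [hf y]
        congr 2
        simp only [hy]; push_cast; ring
      have e2 : f i = act2 (Fin.castSucc x) (Fin.last k) (Rmat N (ξ + i * ζ) ζ τ) := hf x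
      rw [e1, e2, extP_swap]
      exact pair_zero hτ hne _ (fun h => hxy (Fin.castSucc_injective _ h))
        (Fin.castSucc_lt_last x).ne (Fin.castSucc_lt_last y).ne
    · rw [PM_asym, Equiv.Perm.sign_swap hxy]; simp
  have hall : ∀ σ : Equiv.Perm (Fin k), PM N (extP σ) * (MM f k * asymExt N k) =
      ((Equiv.Perm.sign σ : ℤ) : ℂ) • (MM f k * asymExt N k) := by
    clear_value f
    obtain ⟨n, rfl⟩ : ∃ n, k = n + 1 := ⟨k - 1, by omega⟩
    intro σ
    have hσ : σ ∈ Submonoid.closure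
        (Set.range fun i : Fin n ↦ Equiv.swap i.castSucc i.succ) := by
      rw [Equiv.Perm.mclosure_swap_castSucc_succ]; trivial
    induction hσ using Submonoid.closure_induction with
    | mem x hx =>
      obtain ⟨i, rfl⟩ := hx
      have h1 := hadj i (by omega)
      have e : (Equiv.swap (⟨i, by omega⟩ : Fin (n+1)) ⟨i + 1, by omega⟩) =
        Equiv.swap i.castSucc i.succ := rfl
      rw [e] at h1
      simp only
      rw [h1, Equiv.Perm.sign_swap (Fin.castSucc_lt_succ).ne]
      simp
    | one => rw [extP_one, PM_one]; simp
    | mul x y _ _ hx hy =>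
      rw [← extP_mul, ← PM_mul, Matrix.mul_assoc, hy, Matrix.mul_smul, hx, smul_smul,
        Equiv.Perm.sign_mul]
      push_cast
      rw [mul_comm]
  exact inv_preserves _ _ _ (asym_mul N _ (PM_asym N)) (asym_mul N _ hall) hLM

end helpers6

/-- Fused antisymmetrizer identity for inverse R-matrices:
`R₁₀(z)⁻¹ R₂₀(qz)⁻¹ ⋯ Rₖ₀(q^{k-1}z)⁻¹ A_k = A_k R₁₀(z)⁻¹ ⋯ Rₖ₀(q^{k-1}z)⁻¹ A_k`,
the `i`-th factor acting at argument `q^{i-1}z = eπ (ξ + (i-1)ζ)`. -/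
theorem fused_antisymmetrizer_Rinv (N k : ℕ) (hN : 2 ≤ N) (hk2 : 2 ≤ k) (hkN : k ≤ N)
    (ξ ζ τ : ℂ) (hτ : 0 < τ.im) (hζ : 0 < ζ.im)
    (hgen : ∀ i : Fin k, Rgeneric N (ξ + i * ζ) ζ τ)
    (hinv : ∀ i : Fin k,
      IsUnit (act2 (Fin.castSucc i) (Fin.last k) (Rmat N (ξ + i * ζ) ζ τ))) :
    (List.ofFn fun i : Fin k =>
        (act2 (Fin.castSucc i) (Fin.last k) (Rmat N (ξ + i * ζ) ζ τ))⁻¹).prod * asymExt N k =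
      asymExt N k * (List.ofFn fun i : Fin k =>
        (act2 (Fin.castSucc i) (Fin.last k) (Rmat N (ξ + i * ζ) ζ τ))⁻¹).prod * asymExt N k := by
  exact fused_aux N k hN hk2 ξ ζ τ hτ hgen hinv

end
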